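/- For every c ∈ (1,2) and ε ∈ (0, min{1/4, 2−c}) there exists C > 0 such that for every j ∈ ℕ and every (ξ,λ) ∈ [-1/2,1/2)² outside the major box 𝔐_j = {|ξ| ≤ 2^{(2ε−1)j}, |λ| ≤ 2^{(ε−c)j}}, we have |m_j(ξ,λ)| ≤ C · 2^{−εj/4}, where m_j(ξ,λ) = ∑_{n≠0} e^{2πi(λ⌊|n|^c⌋ − ξn)} ψ_j(n). -/

import Mathlib

open MeasureTheory

/-- `e x = e^{2πix}` -/
noncomputable def e (x : ℝ) : ℂ := Complex.exp (2 * Real.pi * Complex.I * x)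

/-- The smooth dyadic piece `ψ_j(x) = (φ(2^{-j}x) - φ(2^{-j+1}x))/x` of the kernel `1/x`. -/
noncomputable def psi (φ : ℝ → ℝ) (j : ℕ) (x : ℝ) : ℝ :=
  (φ ((2 : ℝ) ^ (-(j : ℝ)) * x) - φ ((2 : ℝ) ^ (-(j : ℝ) + 1) * x)) / x

/-- The multiplier `m_j(ξ,λ) = ∑_{n ≠ 0} e(λ⌊|n|^c⌋ - ξn) ψ_j(n)`. -/
noncomputable def mj (φ : ℝ → ℝ) (c : ℝ) (j : ℕ) (ξ lam : ℝ) : ℂ :=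
  ∑' n : ℤ, if n = 0 then 0 else
    e (lam * (⌊|(n : ℝ)| ^ c⌋ : ℝ) - ξ * (n : ℝ)) * (psi φ j (n : ℝ) : ℂ)


lemma e_norm (x : ℝ) : ‖e x‖ = 1 := by
  have : e x = Complex.exp ((2 * Real.pi * x : ℝ) * Complex.I) := by
    unfold e; congr 1; push_cast; ring
  rw [this, Complex.norm_exp_ofReal_mul_I]

lemma e_add (x y : ℝ) : e (x + y) = e x * e y := by
  unfold e; rw [← Complex.exp_add]; congr 1; push_cast; ring

lemma e_zero : e 0 = 1 := by simp [e]

lemma e_int (k : ℤ) : e k = 1 := by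
  unfold e
  rw [Complex.exp_eq_one_iff]
  exact ⟨k, by push_cast; ring⟩

lemma e_sub_one_norm (x : ℝ) : ‖e x - 1‖ = 2 * |Real.sin (Real.pi * x)| := by
  have h : e x = Complex.exp (Complex.I * (2 * Real.pi * x : ℝ)) := by
    unfold e; congr 1; push_cast; ring
  rw [h, Complex.norm_exp_I_mul_ofReal_sub_one, norm_mul, Real.norm_eq_abs, Real.norm_eq_abs]
  norm_num
  congr 1; ring_nf

lemma e_sub_one_le (x : ℝ) : ‖e x - 1‖ ≤ 2 * Real.pi * |x| := by
  rw [e_sub_one_norm]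
  have := Real.abs_sin_le_abs (x := Real.pi * x)
  rw [abs_mul, abs_of_pos Real.pi_pos] at this
  linarith

lemma e_sub_le (x y : ℝ) : ‖e x - e y‖ ≤ 2 * Real.pi * |x - y| := by
  have : e x - e y = e y * (e (x - y) - 1) := by
    rw [mul_sub, ← e_add]; simp
  rw [this, norm_mul, e_norm, one_mul]
  exact e_sub_one_le _

lemma e_sub_one_ge (x : ℝ) (hx : |x| ≤ 1 / 2) : 4 * |x| ≤ ‖e x - 1‖ := by
  rw [e_sub_one_norm]
  have h := Real.mul_abs_le_abs_sin (x := Real.pi * x) (by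
    rw [abs_mul, abs_of_pos Real.pi_pos]; nlinarith [Real.pi_pos])
  rw [abs_mul, abs_of_pos Real.pi_pos] at h
  have : 2 / Real.pi * (Real.pi * |x|) = 2 * |x| := by field_simp
  linarith

lemma e_sub_int (x : ℝ) (k : ℤ) : e (x - k) = e x := by
  have := e_add (x - k) k
  rw [e_int, mul_one] at this
  rw [← this]; simp

lemma e_neg (x : ℝ) : e (-x) = (starRingEnd ℂ) (e x) := by
  unfold e
  rw [← Complex.exp_conj]
  congr 1
  simp [Complex.conj_ofNat]

lemma w_diff (z z' : ℂ) (ρ : ℝ) (hρ : 0 < ρ) :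
    ‖(starRingEnd ℂ) z / ((‖z‖ ^ 2 + ρ : ℝ) : ℂ) - (starRingEnd ℂ) z' / ((‖z'‖ ^ 2 + ρ : ℝ) : ℂ)‖
      ≤ ‖z - z'‖ * ((1 / (‖z‖ ^ 2 + ρ) + 1 / (‖z'‖ ^ 2 + ρ)) / 2) := by
  have hD : 0 < ‖z‖ ^ 2 + ρ := by positivity
  have hD' : 0 < ‖z'‖ ^ 2 + ρ := by positivity
  have hDc : ((‖z‖ ^ 2 + ρ : ℝ) : ℂ) ≠ 0 := by exact_mod_cast hD.ne'
  have hDc' : ((‖z'‖ ^ 2 + ρ : ℝ) : ℂ) ≠ 0 := by exact_mod_cast hD'.ne'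
  have h1 : (starRingEnd ℂ) z / ((‖z‖ ^ 2 + ρ : ℝ) : ℂ) - (starRingEnd ℂ) z' / ((‖z'‖ ^ 2 + ρ : ℝ) : ℂ)
      = (ρ * (starRingEnd ℂ) (z - z') + (starRingEnd ℂ) z * (starRingEnd ℂ) z' * (z' - z)) /
        (((‖z‖ ^ 2 + ρ : ℝ) : ℂ) * ((‖z'‖ ^ 2 + ρ : ℝ) : ℂ)) := by
    rw [div_sub_div _ _ hDc hDc']
    congr 1
    push_cast
    rw [← Complex.mul_conj', ← Complex.mul_conj', map_sub]
    ring
  rw [h1, norm_div, norm_mul (_ : ℂ) (_ : ℂ), Complex.norm_real, Complex.norm_real, Real.norm_of_nonneg hD.le,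
    Real.norm_of_nonneg hD'.le]
  have h2 : ‖(ρ * (starRingEnd ℂ) (z - z') + (starRingEnd ℂ) z * (starRingEnd ℂ) z' * (z' - z))‖
      ≤ ‖z - z'‖ * (ρ + ‖z‖ * ‖z'‖) := by
    refine (norm_add_le _ _).trans ?_
    rw [norm_mul, norm_mul, norm_mul, Complex.norm_conj, Complex.norm_conj, Complex.norm_conj,
      Complex.norm_real, Real.norm_of_nonneg hρ.le, norm_sub_rev z' z]
    apply le_of_eq; ring
  have h3 : (1 / (‖z‖ ^ 2 + ρ) + 1 / (‖z'‖ ^ 2 + ρ)) / 2 =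
      ((‖z‖ ^ 2 + ρ + (‖z'‖ ^ 2 + ρ)) / 2) / ((‖z‖ ^ 2 + ρ) * (‖z'‖ ^ 2 + ρ)) := by
    field_simp; ring
  rw [h3, ← mul_div_assoc]
  gcongr
  refine h2.trans ?_
  gcongr
  nlinarith [sq_nonneg (‖z‖ - ‖z'‖)]

lemma arctan_step (ρ t s : ℝ) (hρ : 0 < ρ) (hρ1 : ρ ≤ 1) (hs : t + ρ ≤ s) :
    ρ / (t ^ 2 + ρ) ≤ 3 / √ρ * (Real.arctan (s / √ρ) - Real.arctan (t / √ρ)) := by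
  have hr : 0 < √ρ := Real.sqrt_pos.2 hρ
  have hr1 : √ρ ≤ 1 := Real.sqrt_le_one.2 hρ1
  have hrr : √ρ * √ρ = ρ := Real.mul_self_sqrt hρ.le
  set r := √ρ with hrdef
  set x := t / r with hx
  have hxt : t = x * r := by rw [hx]; field_simp
  have h1 : Real.arctan (x + r) ≤ Real.arctan (s / r) := by
    apply Real.arctan_mono
    rw [le_div_iff₀ hr]; nlinarith
  have h2 : r / (3 * (1 + x ^ 2)) ≤ Real.arctan (x + r) - Real.arctan x := by
    obtain ⟨y, hy, hy2⟩ := exists_hasDerivAt_eq_slope Real.arctan (fun y => 1 / (1 + y ^ 2))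
      (show x < x + r by linarith) Real.continuous_arctan.continuousOn
      (fun y _ => Real.hasDerivAt_arctan y)
    rw [add_sub_cancel_left, eq_div_iff hr.ne'] at hy2
    rw [← hy2, div_mul_eq_mul_div, one_mul]
    gcongr
    have := hy.1
    have := hy.2
    have : y ^ 2 ≤ 2 * x ^ 2 + 2 := by
      have : (y - x) ^ 2 ≤ 1 := by nlinarith
      nlinarith [sq_nonneg (y - 2 * x)]
    nlinarith
  calc ρ / (t ^ 2 + ρ) = 3 / r * (r / (3 * (1 + x ^ 2))) := by
        rw [hxt, ← hrr]; field_simp; ring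
    _ ≤ _ := by gcongr; linarith

lemma sum_one_center (ρ k : ℝ) (hρ : 0 < ρ) (hρ1 : ρ ≤ 1) (g : ℕ → ℝ) (a b : ℕ) (hab : a ≤ b)
    (hg : ∀ n, a ≤ n → n < b → ρ ≤ g (n + 1) - g n) :
    ∑ n ∈ Finset.Ico a (b + 1), ρ / ((g n - k) ^ 2 + ρ) ≤ 11 / √ρ := by
  have hr : 0 < √ρ := Real.sqrt_pos.2 hρ
  have hr1 : √ρ ≤ 1 := Real.sqrt_le_one.2 hρ1
  rw [Finset.sum_Ico_succ_top hab]
  have h1 : ∑ n ∈ Finset.Ico a b, ρ / ((g n - k) ^ 2 + ρ) ≤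
      ∑ n ∈ Finset.Ico a b, (3 / √ρ * Real.arctan ((g (n + 1) - k) / √ρ)
        - 3 / √ρ * Real.arctan ((g n - k) / √ρ)) := by
    apply Finset.sum_le_sum
    intro n hn
    rw [Finset.mem_Ico] at hn
    rw [← mul_sub]
    apply arctan_step _ _ _ hρ hρ1
    linarith [hg n hn.1 hn.2]
  rw [Finset.sum_Ico_sub (fun n => 3 / √ρ * Real.arctan ((g n - k) / √ρ)) hab] at h1
  have h2 := Real.arctan_lt_pi_div_two ((g b - k) / √ρ)
  have h3 := Real.neg_pi_div_two_lt_arctan ((g a - k) / √ρ)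
  have h4 : ρ / ((g b - k) ^ 2 + ρ) ≤ 1 := by
    rw [div_le_one (by positivity)]; nlinarith [sq_nonneg (g b - k)]
  have h5 : 1 ≤ 1 / √ρ := by rw [le_div_iff₀ hr]; linarith
  have h6 : 3 / √ρ * Real.arctan ((g b - k) / √ρ) - 3 / √ρ * Real.arctan ((g a - k) / √ρ)
      ≤ 3 / √ρ * (10 / 3) := by
    rw [← mul_sub]
    gcongr
    linarith [Real.pi_lt_d2]
  have h7 : 3 / √ρ * (10 / 3) + 1 / √ρ = 11 / √ρ := by field_simp; norm_num
  linarith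

lemma sum_centers (ρ A : ℝ) (hρ : 0 < ρ) (hρ1 : ρ ≤ 1) (g : ℕ → ℝ) (a b : ℕ) (hab : a ≤ b)
    (hg : ∀ n, a ≤ n → n < b → ρ ≤ g (n + 1) - g n)
    (hg' : ∀ n, a ≤ n → n < b → g (n + 1) - g n ≤ A * ρ) :
    ∑ n ∈ Finset.Ico a (b + 1), ρ / (‖e (g n) - 1‖ ^ 2 + ρ) ≤
      11 / √ρ * (A * ρ * ((b : ℝ) - a) + 2) := by
  have hr : 0 < √ρ := Real.sqrt_pos.2 hρ
  have hmono : ∀ n, a ≤ n → n ≤ b → g a ≤ g n := by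
    intro n han
    induction n, han using Nat.le_induction with
    | base => intro _; exact le_rfl
    | succ n hn ih => intro h; linarith [ih (by omega), hg n hn (by omega)]
  have hmono' : ∀ n, a ≤ n → n ≤ b → g n ≤ g a + A * ρ * ((n : ℝ) - a) := by
    intro n han
    induction n, han using Nat.le_induction with
    | base => intro _; simp
    | succ n hn ih => intro h; have := ih (by omega); have := hg' n hn (by omega); push_cast; linarith
  have hmonob : ∀ n, a ≤ n → n ≤ b → g n ≤ g b := by
    intro n han hnb
    have : ∀ m, n ≤ m → m ≤ b → g n ≤ g m := by
      intro m hm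
      induction m, hm using Nat.le_induction with
      | base => intro _; exact le_rfl
      | succ m hm ih => intro h; linarith [ih (by omega), hg m (by omega) (by omega)]
    exact this b hnb le_rfl
  set k0 := ⌊g a + 1/2⌋
  set k1 := ⌊g b + 1/2⌋
  have hk : k0 ≤ k1 := Int.floor_mono (by linarith [hmono b hab le_rfl])
  have h1 : ∀ n ∈ Finset.Ico a (b+1), ρ / (‖e (g n) - 1‖ ^ 2 + ρ) ≤
      ∑ k ∈ Finset.Icc k0 k1, ρ / ((g n - k) ^ 2 + ρ) := by
    intro n hn
    rw [Finset.mem_Ico] at hn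
    set k := ⌊g n + 1/2⌋ with hkdef
    have hkm : k ∈ Finset.Icc k0 k1 := by
      rw [Finset.mem_Icc]
      exact ⟨Int.floor_mono (by linarith [hmono n hn.1 (by omega)]),
        Int.floor_mono (by linarith [hmonob n hn.1 (by omega)])⟩
    refine le_trans ?_ (Finset.single_le_sum (f := fun k : ℤ => ρ / ((g n - k) ^ 2 + ρ))
      (fun i _ => by positivity) hkm)
    have h2 : |g n - k| ≤ 1/2 := by
      have := Int.floor_le (g n + 1/2)
      have := Int.lt_floor_add_one (g n + 1/2)
      rw [abs_le]; constructor <;> linarith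
    have h3 := e_sub_one_ge _ h2
    rw [e_sub_int] at h3
    have : (g n - k) ^ 2 ≤ ‖e (g n) - 1‖ ^ 2 := by
      rw [← sq_abs]
      gcongr
      linarith [abs_nonneg (g n - k)]
    gcongr
  refine (Finset.sum_le_sum h1).trans ?_
  rw [Finset.sum_comm]
  refine (Finset.sum_le_sum (fun (k : ℤ) _ => sum_one_center ρ k hρ hρ1 g a b hab hg)).trans ?_
  rw [Finset.sum_const, Int.card_Icc, nsmul_eq_mul, mul_comm]
  gcongr
  have h4 : (((k1 + 1 - k0).toNat : ℤ) : ℝ) = k1 + 1 - k0 := by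
    rw [Int.toNat_of_nonneg (by omega)]; push_cast; ring
  rw [Int.cast_natCast] at h4
  rw [h4]
  have := Int.floor_le (g b + 1/2)
  have := Int.lt_floor_add_one (g a + 1/2)
  linarith [hmono' b hab le_rfl]

lemma vdc (ρ A : ℝ) (hρ : 0 < ρ) (hρ1 : ρ ≤ 1) (hA : 1 ≤ A) (f : ℕ → ℝ) (a b : ℕ) (hab : a ≤ b)
    (h1 : ∀ n, a ≤ n → n < b → ρ ≤ f (n + 2) - 2 * f (n + 1) + f n)
    (h2 : ∀ n, a ≤ n → n < b → f (n + 2) - 2 * f (n + 1) + f n ≤ A * ρ) :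
    ‖∑ n ∈ Finset.Ico a b, e (f n)‖ ≤ 200 * A ^ 2 * (√ρ * ((b : ℝ) - a) + 1 / √ρ) := by
  have hr : 0 < √ρ := Real.sqrt_pos.2 hρ
  have hrr : √ρ * √ρ = ρ := Real.mul_self_sqrt hρ.le
  set g : ℕ → ℝ := fun n => f (n + 1) - f n with hg
  have hg1 : ∀ n, a ≤ n → n < b → ρ ≤ g (n + 1) - g n := fun n hn hn' => by
    have := h1 n hn hn'; simp only [hg]; linarith
  have hg2 : ∀ n, a ≤ n → n < b → g (n + 1) - g n ≤ A * ρ := fun n hn hn' => by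
    have := h2 n hn hn'; simp only [hg]; linarith
  have hS := sum_centers ρ A hρ hρ1 g a b hab hg1 hg2
  set S := ∑ n ∈ Finset.Ico a (b + 1), ρ / (‖e (g n) - 1‖ ^ 2 + ρ) with hSdef
  set z : ℕ → ℂ := fun n => e (g n) - 1 with hz
  set D : ℕ → ℝ := fun n => ‖z n‖ ^ 2 + ρ with hD
  have hDpos : ∀ n, 0 < D n := fun n => by positivity
  set w : ℕ → ℂ := fun n => (starRingEnd ℂ) (z n) / (D n : ℂ) with hw
  have hwn : ∀ n, ‖w n‖ ≤ 1 / (2 * √ρ) := by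
    intro n
    simp only [hw]
    rw [norm_div, Complex.norm_conj, Complex.norm_real, Real.norm_of_nonneg (hDpos n).le,
      div_le_div_iff₀ (hDpos n) (by positivity)]
    simp only [hD]
    nlinarith [sq_nonneg (‖z n‖ - √ρ)]
  have hkey : ∀ n, e (f n) = e (f n) * ((ρ / D n : ℝ) : ℂ) +
      ((e (f (n + 1)) * w (n + 1) - e (f n) * w n) - e (f (n + 1)) * (w (n + 1) - w n)) := by
    intro n
    have hDc : (D n : ℂ) ≠ 0 := by exact_mod_cast (hDpos n).ne'
    have he : e (f (n + 1)) = e (f n) * (z n + 1) := by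
      simp only [hz, hg, sub_add_cancel]
      rw [← e_add]; simp
    have hzw : z n * w n = 1 - ((ρ / D n : ℝ) : ℂ) := by
      simp only [hw]
      rw [mul_div_assoc', Complex.mul_conj']
      push_cast
      rw [eq_sub_iff_add_eq, ← add_div, div_eq_one_iff_eq hDc]
      simp [hD]
    have : e (f (n + 1)) * w n - e (f n) * w n = e (f n) * (z n * w n) := by rw [he]; ring
    rw [hzw] at this
    linear_combination -this
  rw [Finset.sum_congr rfl (fun n _ => hkey n), Finset.sum_add_distrib, Finset.sum_sub_distrib,
    Finset.sum_Ico_sub (fun n => e (f n) * w n) hab]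
  have hsub1 : ∑ n ∈ Finset.Ico a b, ρ / D n ≤ S := by
    apply Finset.sum_le_sum_of_subset_of_nonneg
    · intro n; simp only [Finset.mem_Ico]; omega
    · intro n _ _; have := hDpos n; positivity
  have hsub2 : ∑ n ∈ Finset.Ico a b, ρ / D (n + 1) ≤ S := by
    rw [Finset.sum_Ico_add' (fun n => ρ / D n) a b 1]
    apply Finset.sum_le_sum_of_subset_of_nonneg
    · intro n; simp only [Finset.mem_Ico]; omega
    · intro n _ _; have := hDpos n; positivity
  have b1 : ‖∑ n ∈ Finset.Ico a b, e (f n) * ((ρ / D n : ℝ) : ℂ)‖ ≤ S := by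
    refine (norm_sum_le _ _).trans (le_trans (le_of_eq ?_) hsub1)
    apply Finset.sum_congr rfl
    intro n _
    have := hDpos n
    rw [norm_mul, e_norm, one_mul, Complex.norm_real, Real.norm_of_nonneg (by positivity)]
  have b2 : ‖∑ n ∈ Finset.Ico a b, e (f (n + 1)) * (w (n + 1) - w n)‖ ≤ 2 * Real.pi * A * S := by
    have : ∀ n ∈ Finset.Ico a b, ‖e (f (n + 1)) * (w (n + 1) - w n)‖ ≤
        Real.pi * A * (ρ / D (n + 1) + ρ / D n) := by
      intro n hn
      rw [Finset.mem_Ico] at hn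
      rw [norm_mul, e_norm, one_mul]
      refine (w_diff (z (n + 1)) (z n) ρ hρ).trans ?_
      have h3 : ‖z (n + 1) - z n‖ ≤ 2 * Real.pi * (A * ρ) := by
        simp only [hz]
        rw [sub_sub_sub_cancel_right]
        refine (e_sub_le _ _).trans ?_
        have := hg1 n hn.1 hn.2
        have := hg2 n hn.1 hn.2
        rw [abs_of_nonneg (by linarith)]
        gcongr
      have hd1 := hDpos n
      have hd2 := hDpos (n + 1)
      calc _ ≤ 2 * Real.pi * (A * ρ) * ((1 / D (n + 1) + 1 / D n) / 2) := by
            simp only [hD]; gcongr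
        _ = _ := by ring
    refine (norm_sum_le _ _).trans ((Finset.sum_le_sum this).trans ?_)
    rw [← Finset.mul_sum, Finset.sum_add_distrib]
    have : 0 < Real.pi * A := by positivity
    nlinarith
  have b3 : ‖e (f b) * w b - e (f a) * w a‖ ≤ 1 / √ρ := by
    refine (norm_sub_le _ _).trans ?_
    rw [norm_mul, norm_mul, e_norm, e_norm]
    have : 1 / √ρ = 1 / (2 * √ρ) + 1 / (2 * √ρ) := by field_simp; norm_num
    linarith [hwn a, hwn b]
  have b4 : ‖_‖ ≤ _ := (norm_add_le _ _).trans (add_le_add b1 ((norm_sub_le _ _).trans (add_le_add b3 b2)))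
  refine b4.trans ?_
  have hM : (0 : ℝ) ≤ (b : ℝ) - a := by
    have : (a : ℝ) ≤ b := by exact_mod_cast hab
    linarith
  have e1 : 11 / √ρ * (A * ρ * ((b : ℝ) - a) + 2) = 11 * A * (√ρ * ((b : ℝ) - a)) + 22 * (1 / √ρ) := by
    have h0 : ρ / √ρ = √ρ := Real.div_sqrt
    linear_combination (11 * A * ((b : ℝ) - a)) * h0
  have hP : 0 ≤ √ρ * ((b : ℝ) - a) := by positivity
  have hQ : 0 ≤ 1 / √ρ := by positivity
  rw [e1] at hS
  generalize √ρ * ((b : ℝ) - a) = P at *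
  generalize 1 / √ρ = Q at *
  have hpi := Real.pi_lt_d2
  have hpi0 := Real.pi_pos
  have h8 : S + (Q + 2 * Real.pi * A * S) ≤ Q + (1 + 2 * Real.pi * A) * (11 * A * P + 22 * Q) := by
    have : 0 ≤ 1 + 2 * Real.pi * A := by positivity
    nlinarith
  have h9 : 1 + 2 * Real.pi * A ≤ 8 * A := by nlinarith
  have h10 : (1 + 2 * Real.pi * A) * (11 * A * P + 22 * Q) ≤ 8 * A * (11 * A * P + 22 * Q) := by
    gcongr
  have h11 : A * Q ≤ A ^ 2 * Q := by gcongr; nlinarith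
  have h12 : Q ≤ A ^ 2 * Q := by nlinarith
  have h13 : 0 ≤ A ^ 2 * P := by positivity
  nlinarith

lemma norm_sum_e_neg (f : ℕ → ℝ) (s : Finset ℕ) :
    ‖∑ n ∈ s, e (-f n)‖ = ‖∑ n ∈ s, e (f n)‖ := by
  simp_rw [e_neg]
  rw [← map_sum, Complex.norm_conj]

lemma second_diff (c x : ℝ) (hc1 : 1 < c) (hx : 0 < x) :
    ∃ y, x < y ∧ y < x + 2 ∧
      (x + 2) ^ c - 2 * (x + 1) ^ c + x ^ c = c * (c - 1) * y ^ (c - 2) := by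
  have hd : ∀ (p t : ℝ), 0 < t → HasDerivAt (fun t : ℝ => t ^ p) (p * t ^ (p - 1)) t :=
    fun p t ht => Real.hasDerivAt_rpow_const (Or.inl ht.ne')
  have hd1 : ∀ t, 0 < t → HasDerivAt (fun t : ℝ => (t + 1) ^ c - t ^ c)
      (c * (t + 1) ^ (c - 1) - c * t ^ (c - 1)) t := by
    intro t ht
    exact ((hd c (t + 1) (by linarith)).comp_add_const t 1).sub (hd c t ht)
  obtain ⟨u, hu, hu2⟩ := exists_hasDerivAt_eq_slope (fun t : ℝ => (t + 1) ^ c - t ^ c)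
    (fun t => c * (t + 1) ^ (c - 1) - c * t ^ (c - 1)) (show x < x + 1 by linarith)
    (fun t ht => (hd1 t (by linarith [ht.1])).continuousAt.continuousWithinAt)
    (fun t ht => hd1 t (by linarith [ht.1]))
  have hu0 : 0 < u := by linarith [hu.1]
  obtain ⟨v, hv, hv2⟩ := exists_hasDerivAt_eq_slope (fun t : ℝ => t ^ (c - 1))
    (fun t => (c - 1) * t ^ (c - 1 - 1)) (show u < u + 1 by linarith)
    (fun t ht => (hd (c - 1) t (by linarith [ht.1])).continuousAt.continuousWithinAt)
    (fun t ht => hd (c - 1) t (by linarith [ht.1]))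
  refine ⟨v, by linarith [hv.1, hu.1], by linarith [hv.2, hu.2], ?_⟩
  simp only [add_sub_cancel_left, div_one] at hu2 hv2
  rw [show c - 1 - 1 = c - 2 by ring] at hv2
  rw [show x + 1 + 1 = x + 2 by ring] at hu2
  linear_combination (-1) * hu2 - c * hv2

/-- exponential sums with phase `θ n^c - ξ n` -/
lemma S_bound (c : ℝ) (hc1 : 1 < c) (hc2 : c < 2) :
    ∃ C > (0 : ℝ), ∀ (θ ξ : ℝ) (a b : ℕ), θ ≠ 0 → 1 ≤ a → a ≤ b → b ≤ 4 * a + 1 →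
      ‖∑ n ∈ Finset.Ico a b, e (θ * (n : ℝ) ^ c - ξ * n)‖ ≤
        C * (√|θ| * (a : ℝ) ^ (c / 2) + (a : ℝ) ^ (1 - c / 2) / √|θ|) := by
  set κ : ℝ := c * (c - 1) * 6 ^ (c - 2) with hκ
  have hκ0 : 0 < κ := by have : 0 < c - 1 := by linarith
                         positivity
  set A : ℝ := 6 ^ (2 - c) with hA
  have hA1 : 1 ≤ A := Real.one_le_rpow (by norm_num) (by linarith)
  have hAκ : A * κ = c * (c - 1) := by
    have : (6 : ℝ) ^ (2 - c) * 6 ^ (c - 2) = 1 := by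
      rw [← Real.rpow_add (by norm_num)]; simp
    rw [hA, hκ]; linear_combination (c * (c - 1)) * this
  -- positive case
  have main : ∀ (θ ξ : ℝ) (a b : ℕ), 0 < θ → 1 ≤ a → a ≤ b → b ≤ 4 * a + 1 →
      ‖∑ n ∈ Finset.Ico a b, e (θ * (n : ℝ) ^ c - ξ * n)‖ ≤
        (200 * A ^ 2 * (4 * √κ + 1 / √κ) + 4 * √κ) *
          (√θ * (a : ℝ) ^ (c / 2) + (a : ℝ) ^ (1 - c / 2) / √θ) := by
    intro θ ξ a b hθ ha hab hb
    have ha' : (1 : ℝ) ≤ a := by exact_mod_cast ha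
    have ha0 : (0 : ℝ) < a := by linarith
    have hb' : (b : ℝ) - a ≤ 4 * a := by
      have : (b : ℝ) ≤ 4 * a + 1 := by exact_mod_cast hb
      linarith
    have hab' : (0 : ℝ) ≤ (b : ℝ) - a := by
      have : (a : ℝ) ≤ b := by exact_mod_cast hab
      linarith
    set ρ := θ * κ * (a : ℝ) ^ (c - 2) with hρdef
    have hρ : 0 < ρ := by positivity
    have hsq : √ρ = √θ * √κ * (a : ℝ) ^ (c / 2 - 1) := by
      rw [hρdef, Real.sqrt_mul (by positivity), Real.sqrt_mul hθ.le]
      congr 1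
      rw [Real.sqrt_eq_rpow, ← Real.rpow_mul ha0.le]
      congr 1; ring
    have hp1 : (a : ℝ) ^ (c / 2 - 1) * a = (a : ℝ) ^ (c / 2) := by
      rw [← Real.rpow_add_one ha0.ne']; congr 1; ring
    have hp2 : 1 / (a : ℝ) ^ (c / 2 - 1) = (a : ℝ) ^ (1 - c / 2) := by
      rw [one_div, ← Real.rpow_neg ha0.le]; congr 1; ring
    have hκs : 0 < √κ := Real.sqrt_pos.2 hκ0
    have hθs : 0 < √θ := Real.sqrt_pos.2 hθ
    have hP : √ρ * ((b : ℝ) - a) ≤ 4 * √κ * (√θ * (a : ℝ) ^ (c / 2)) := by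
      calc √ρ * ((b : ℝ) - a) ≤ √ρ * (4 * a) := by gcongr
        _ = _ := by rw [hsq, ← hp1]; ring
    have hQ : 1 / √ρ = 1 / √κ * ((a : ℝ) ^ (1 - c / 2) / √θ) := by
      rw [hsq, ← hp2]; field_simp
    have hU : 0 ≤ √θ * (a : ℝ) ^ (c / 2) := by positivity
    have hV : 0 ≤ (a : ℝ) ^ (1 - c / 2) / √θ := by positivity
    rcases le_or_gt ρ 1 with hρ1 | hρ1
    · have hv := vdc ρ A hρ hρ1 hA1 (fun n => θ * (n : ℝ) ^ c - ξ * n) a b hab ?_ ?_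
      · refine hv.trans ?_
        rw [hQ]
        generalize √θ * (a : ℝ) ^ (c / 2) = U at *
        generalize (a : ℝ) ^ (1 - c / 2) / √θ = V at *
        have hk2 : 0 < 1 / √κ := by positivity
        have hA2 : 0 < 200 * A ^ 2 := by positivity
        generalize 1 / √κ = q at *
        calc 200 * A ^ 2 * (√ρ * ((b : ℝ) - a) + q * V) ≤ 200 * A ^ 2 * (4 * √κ * U + q * V) := by gcongr
          _ ≤ 200 * A ^ 2 * ((4 * √κ + q) * (U + V)) := by
              gcongr
              have : 0 ≤ √κ * V := by positivity
              have : 0 ≤ q * U := by positivity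
              nlinarith
          _ ≤ (200 * A ^ 2 * (4 * √κ + q) + 4 * √κ) * (U + V) := by
              have : 0 ≤ 4 * √κ * (U + V) := by positivity
              nlinarith
      · intro n hn hn'
        obtain ⟨y, hy1, hy2, hy⟩ := second_diff c n hc1 (by
          have : (a : ℝ) ≤ n := by exact_mod_cast hn
          linarith)
        have hya : y ≤ 6 * a := by
          have : (n : ℝ) ≤ 4 * a := by exact_mod_cast (by omega : n ≤ 4 * a)
          linarith
        have hn0 : (0 : ℝ) ≤ n := by positivity
        have h6 : (6 * (a : ℝ)) ^ (c - 2) ≤ y ^ (c - 2) :=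
          Real.rpow_le_rpow_of_nonpos (by linarith) hya (by linarith)
        rw [Real.mul_rpow (by norm_num) ha0.le] at h6
        push_cast
        have e1 : θ * ((n : ℝ) + 2) ^ c - ξ * (n + 2) - 2 * (θ * ((n : ℝ) + 1) ^ c - ξ * (n + 1)) +
          (θ * (n : ℝ) ^ c - ξ * n) = θ * (c * (c - 1) * y ^ (c - 2)) := by rw [← hy]; ring
        rw [e1, hρdef, hκ]
        have : 0 < c - 1 := by linarith
        calc _ = θ * (c * (c - 1) * (6 ^ (c - 2) * (a : ℝ) ^ (c - 2))) := by ring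
          _ ≤ _ := by gcongr
      · intro n hn hn'
        have hna : (a : ℝ) ≤ n := by exact_mod_cast hn
        obtain ⟨y, hy1, hy2, hy⟩ := second_diff c n hc1 (by linarith)
        have h6 : y ^ (c - 2) ≤ (a : ℝ) ^ (c - 2) :=
          Real.rpow_le_rpow_of_nonpos ha0 (by linarith) (by linarith)
        push_cast
        have e1 : θ * ((n : ℝ) + 2) ^ c - ξ * (n + 2) - 2 * (θ * ((n : ℝ) + 1) ^ c - ξ * (n + 1)) +
          (θ * (n : ℝ) ^ c - ξ * n) = θ * (c * (c - 1) * y ^ (c - 2)) := by rw [← hy]; ring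
        rw [e1, hρdef]
        have : 0 < c - 1 := by linarith
        calc _ ≤ θ * (c * (c - 1) * (a : ℝ) ^ (c - 2)) := by gcongr
          _ = _ := by rw [← hAκ]; ring
    · have h1 : ‖∑ n ∈ Finset.Ico a b, e (θ * (n : ℝ) ^ c - ξ * n)‖ ≤ (b : ℝ) - a := by
        refine (norm_sum_le _ _).trans ?_
        simp [e_norm, Nat.cast_sub hab]
      have h2 : (1 : ℝ) ≤ √ρ := Real.one_le_sqrt.2 hρ1.le
      have h3 : (b : ℝ) - a ≤ √ρ * ((b : ℝ) - a) := by nlinarith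
      have h4 : 0 ≤ 200 * A ^ 2 * (4 * √κ + 1 / √κ) := by positivity
      generalize √θ * (a : ℝ) ^ (c / 2) = U at *
      generalize (a : ℝ) ^ (1 - c / 2) / √θ = V at *
      have h5 : 0 ≤ 4 * √κ * V := by positivity
      have h6 : 0 ≤ 200 * A ^ 2 * (4 * √κ + 1 / √κ) * (U + V) := by positivity
      nlinarith
  refine ⟨200 * A ^ 2 * (4 * √κ + 1 / √κ) + 4 * √κ, by positivity,
    fun θ ξ a b hθ ha hab hb => ?_⟩
  rcases lt_or_gt_of_ne hθ with h | h
  · have := main (-θ) (-ξ) a b (by linarith) ha hab hb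
    rw [abs_of_neg h, ← norm_sum_e_neg]
    convert this using 6
    ring
  · rw [abs_of_pos h]
    exact main θ ξ a b h ha hab hb

lemma pw_integral (s μ : ℂ) (p : ℝ) (hs : s ≠ 0) (hp0 : 0 ≤ p) (hp1 : p ≤ 1) :
    ∫ x in (0:ℝ)..1, Complex.exp (s * x) * (1 + μ * ((max 0 (x - p) : ℝ) : ℂ)) =
      (Complex.exp s * (1 + μ * (1 - p)) - 1) / s - μ * (Complex.exp s - Complex.exp (s * p)) / s ^ 2 := by
  have hcont : Continuous fun x : ℝ =>
      Complex.exp (s * x) * (1 + μ * ((max 0 (x - p) : ℝ) : ℂ)) := by fun_prop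
  rw [← intervalIntegral.integral_add_adjacent_intervals (b := p)
    (hcont.intervalIntegrable _ _) (hcont.intervalIntegrable _ _)]
  have h1 : ∫ x in (0:ℝ)..p, Complex.exp (s * x) * (1 + μ * ((max 0 (x - p) : ℝ) : ℂ)) =
      ∫ x in (0:ℝ)..p, Complex.exp (s * x) := by
    apply intervalIntegral.integral_congr
    intro x hx
    rw [Set.uIcc_of_le hp0] at hx
    simp only
    rw [max_eq_left (by linarith [hx.2])]
    simp
  have h2 : ∫ x in p..1, Complex.exp (s * x) * (1 + μ * ((max 0 (x - p) : ℝ) : ℂ)) =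
      ∫ x in p..1, Complex.exp (s * x) * (1 + μ * ((x : ℂ) - p)) := by
    apply intervalIntegral.integral_congr
    intro x hx
    rw [Set.uIcc_of_le hp1] at hx
    simp only
    rw [max_eq_right (by linarith [hx.1])]
    push_cast
    rfl
  rw [h1, h2, integral_exp_mul_complex hs]
  have hd : ∀ x : ℝ, HasDerivAt (fun x : ℝ => Complex.exp (s * x) * (1 + μ * ((x : ℂ) - p)) / s
      - μ * Complex.exp (s * x) / s ^ 2) (Complex.exp (s * x) * (1 + μ * ((x : ℂ) - p))) x := by
    intro x
    have hx : HasDerivAt (fun x : ℝ => (x : ℂ)) 1 x := Complex.ofRealCLM.hasDerivAt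
    have he : HasDerivAt (fun x : ℝ => Complex.exp (s * x)) (Complex.exp (s * x) * (s * 1)) x :=
      (hx.const_mul s).cexp
    have hl : HasDerivAt (fun x : ℝ => 1 + μ * ((x : ℂ) - p)) (μ * 1) x :=
      ((hx.sub_const _).const_mul μ).const_add 1
    refine (((he.mul hl).div_const s).sub ((he.const_mul μ).div_const (s ^ 2))).congr_deriv ?_
    field_simp
    ring
  rw [intervalIntegral.integral_eq_sub_of_hasDerivAt (fun x _ => hd x)
    (Continuous.intervalIntegrable (by fun_prop) _ _)]
  simp
  field_simp
  ring

lemma e_fract (m : ℤ) (x : ℝ) : e (m * Int.fract x) = e (m * x) := by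
  rw [Int.fract, mul_sub, ← Int.cast_mul, e_sub_int]

lemma fourier_approx (lam δ : ℝ) (hl : |lam| ≤ 1 / 2) (hδ0 : 0 < δ) (hδ1 : δ < 1) :
    ∃ (ch : ℤ → ℂ) (F : ℝ → ℂ), ‖ch 0‖ ≤ 3 ∧ (∀ m : ℤ, m ≠ 0 → ‖ch m‖ ≤ 1 / (δ * (m : ℝ) ^ 2)) ∧
      (∀ x : ℝ, HasSum (fun m : ℤ => ch m * e (m * x)) (F x)) ∧ (∀ x, ‖F x‖ ≤ 3) ∧
      ∀ x, Int.fract x ≤ 1 - δ → F x = e (-lam * Int.fract x) := by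
  set p := 1 - δ with hp
  set μ : ℂ := (e lam - 1) / δ with hμ
  have hδc : (δ : ℂ) ≠ 0 := by exact_mod_cast hδ0.ne'
  have hμn : ‖μ‖ ≤ 2 / δ := by
    rw [hμ, norm_div, Complex.norm_real, Real.norm_of_nonneg hδ0.le]
    gcongr
    refine (norm_sub_le _ _).trans ?_
    rw [e_norm]; norm_num
  set f0 : ℝ → ℂ := fun x => e (-lam * x) * (1 + μ * ((max 0 (x - p) : ℝ) : ℂ)) with hf0
  have hecont : Continuous e := by unfold e; fun_prop
  have hcont : Continuous f0 := by simp only [hf0]; fun_prop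
  have hbd : ∀ x, x ≤ 1 → ‖f0 x‖ ≤ 3 := by
    intro x hx
    simp only [hf0]
    rw [norm_mul, e_norm, one_mul]
    refine (norm_add_le _ _).trans ?_
    rw [norm_mul, Complex.norm_real, Real.norm_of_nonneg (le_max_left _ _), norm_one]
    have h1 : max 0 (x - p) ≤ δ := max_le hδ0.le (by linarith)
    have h2 : ‖μ‖ * max 0 (x - p) ≤ 2 / δ * δ := by gcongr
    have h3 : 2 / δ * δ = 2 := by field_simp
    linarith
  have hends : f0 0 = f0 1 := by
    simp only [hf0]
    rw [max_eq_left (by linarith), max_eq_right (by linarith), hp, hμ]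
    have : e (-lam * 1) * e lam = 1 := by rw [← e_add]; simp [e_zero]
    simp only [mul_zero, e_zero, Complex.ofReal_zero, add_zero, mul_one]
    rw [show ((1 - (1 - δ) : ℝ) : ℂ) = δ by push_cast; ring, div_mul_cancel₀ _ hδc]
    rw [mul_one] at this
    rw [add_sub_cancel, this]
  have : Fact ((0 : ℝ) < 1) := ⟨one_pos⟩
  let B : C(AddCircle (1 : ℝ), ℂ) := ⟨AddCircle.liftIco 1 0 f0,
    AddCircle.liftIco_zero_continuous hends hcont.continuousOn⟩
  have hco : ∀ m : ℤ, fourierCoeff B m = ∫ x in (0:ℝ)..1,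
      Complex.exp ((-2 * Real.pi * Complex.I * (lam + m)) * x) * (1 + μ * ((max 0 (x - p) : ℝ) : ℂ)) := by
    intro m
    change fourierCoeff (AddCircle.liftIco 1 0 f0) m = _
    rw [fourierCoeff_liftIco_eq, fourierCoeffOn_eq_integral]
    simp only [zero_add, sub_zero, div_one, one_smul]
    apply intervalIntegral.integral_congr
    intro x _
    simp only [hf0, smul_eq_mul]
    rw [← mul_assoc]
    congr 1
    rw [fourier_coe_apply]
    unfold e
    rw [← Complex.exp_add]
    congr 1
    push_cast
    ring
  have hc0 : ‖fourierCoeff B 0‖ ≤ 3 := by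
    rw [hco]
    have := intervalIntegral.norm_integral_le_of_norm_le_const (a := (0:ℝ)) (b := 1) (C := 3)
      (f := fun x : ℝ => Complex.exp ((-2 * Real.pi * Complex.I * (lam + (0 : ℤ))) * x) *
        (1 + μ * ((max 0 (x - p) : ℝ) : ℂ))) (by
        intro x hx
        rw [Set.uIoc_of_le zero_le_one] at hx
        refine le_trans (le_of_eq ?_) (hbd x hx.2)
        congr 1
        simp only [hf0]
        congr 1
        unfold e
        congr 1
        push_cast
        ring)
    simpa using this
  have hcm : ∀ m : ℤ, m ≠ 0 → ‖fourierCoeff B m‖ ≤ 1 / (δ * (m : ℝ) ^ 2) := by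
    intro m hm
    have hm1 : (1 : ℝ) ≤ |(m : ℝ)| := by exact_mod_cast Int.one_le_abs hm
    have hth : |(m : ℝ)| / 2 ≤ |lam + m| := by
      have := abs_sub_abs_le_abs_sub (m : ℝ) (-lam)
      rw [abs_neg, sub_neg_eq_add, add_comm] at this
      linarith
    have hth0 : 0 < |lam + m| := by linarith
    have hthne : (lam + m : ℝ) ≠ 0 := abs_pos.1 hth0
    set s : ℂ := -2 * Real.pi * Complex.I * (lam + m) with hs
    have hsn : ‖s‖ = 2 * Real.pi * |lam + m| := by
      rw [hs]
      simp only [norm_mul, norm_neg, Complex.norm_I, Complex.norm_real]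
      rw [show ((lam : ℂ) + m) = ((lam + m : ℝ) : ℂ) by push_cast; rfl, Complex.norm_real]
      simp [abs_of_pos Real.pi_pos]
    have hs0 : s ≠ 0 := by
      rw [← norm_ne_zero_iff, hsn]
      have := Real.pi_pos
      positivity
    rw [hco, pw_integral s μ p hs0 (by linarith) (by linarith)]
    have hes : ∀ x : ℝ, Complex.exp (s * x) = e (-(lam + m) * x) := by
      intro x; unfold e; congr 1; rw [hs]; push_cast; ring
    have h1 : Complex.exp s = e (-lam) := by
      have := hes 1
      rw [Complex.ofReal_one, mul_one] at this
      rw [this, ← e_sub_int (-lam) m]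
      congr 1; ring
    have h2 : Complex.exp s * (1 + μ * (1 - p)) - 1 = 0 := by
      rw [h1, hμ, hp]
      push_cast
      rw [sub_sub_cancel, div_mul_cancel₀ _ hδc, add_sub_cancel, ← e_add]
      simp [e_zero]
    rw [h2, zero_div, zero_sub, norm_neg, norm_div, norm_mul, norm_pow, hsn]
    have h3 : ‖Complex.exp s - Complex.exp (s * p)‖ ≤ 2 := by
      refine (norm_sub_le _ _).trans ?_
      rw [h1, hes, e_norm, e_norm]; norm_num
    have hpi := Real.pi_gt_three
    have h4 : 4 * (m : ℝ) ^ 2 ≤ (2 * Real.pi * |lam + m|) ^ 2 := by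
      have : 2 * |(m : ℝ)| ≤ 2 * Real.pi * |lam + m| := by nlinarith
      calc 4 * (m : ℝ) ^ 2 = (2 * |(m : ℝ)|) ^ 2 := by rw [mul_pow, sq_abs]; norm_num
        _ ≤ _ := by gcongr
    have hm2 : 0 < (m : ℝ) ^ 2 := by positivity
    calc _ ≤ (2 / δ * 2) / (4 * (m : ℝ) ^ 2) := by gcongr
      _ = _ := by field_simp; norm_num
  have hsum : Summable (fourierCoeff B) := by
    have hs2 : Summable fun m : ℤ => (1 / δ) * (1 / (m : ℝ) ^ 2) :=
      (Real.summable_one_div_int_pow.2 (by norm_num)).mul_left _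
    apply Summable.of_norm_bounded_eventually hs2
    have : ({0} : Set ℤ)ᶜ ∈ Filter.cofinite := (Set.finite_singleton 0).compl_mem_cofinite
    filter_upwards [this] with m hm
    refine (hcm m (by simpa using hm)).trans (le_of_eq ?_)
    rw [one_div_mul_one_div]
  refine ⟨fourierCoeff B, fun x => f0 (Int.fract x), hc0, hcm, ?_, ?_, ?_⟩
  · intro x
    have h := has_pointwise_sum_fourier_series_of_summable hsum ((Int.fract x : ℝ) : AddCircle (1:ℝ))
    have hB : B ((Int.fract x : ℝ) : AddCircle (1:ℝ)) = f0 (Int.fract x) := by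
      change AddCircle.liftIco 1 0 f0 ((Int.fract x : ℝ) : AddCircle (1:ℝ)) = _
      exact AddCircle.liftIco_coe_apply ⟨Int.fract_nonneg x, by simpa using Int.fract_lt_one x⟩
    rw [hB] at h
    refine h.congr_fun ?_
    intro m
    rw [smul_eq_mul, fourier_coe_apply, ← e_fract]
    unfold e
    congr 2
    push_cast
    ring
  · intro x
    exact hbd _ (Int.fract_lt_one x).le
  · intro x hx
    simp only [hf0]
    rw [max_eq_left (by linarith)]
    simp

lemma bad_count (s : Finset ℕ) (x : ℕ → ℝ) (K : ℕ) (hK : 1 ≤ K) (T : ℝ) (hT : 0 ≤ T)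
    (h : ∀ m : ℤ, m ≠ 0 → |m| < K → ‖∑ n ∈ s, e (m * x n)‖ ≤ T) :
    (((s.filter (fun n => 1 - 1 / (16 * (K : ℝ)) < Int.fract (x n))).card : ℕ) : ℝ) ≤
      4 * (s.card / K + T) := by
  have hK' : (1 : ℝ) ≤ K := by exact_mod_cast hK
  have hK0 : (0 : ℝ) < K := by linarith
  set D : ℕ → ℂ := fun n => ∑ k ∈ Finset.range K, e (k * x n) with hD
  have hlow : ∀ n ∈ s.filter (fun n => 1 - 1 / (16 * (K : ℝ)) < Int.fract (x n)),
      (K : ℝ) ^ 2 / 4 ≤ ‖D n‖ ^ 2 := by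
    intro n hn
    rw [Finset.mem_filter] at hn
    have hn2 := hn.2
    have hlt := Int.fract_lt_one (x n)
    set y := Int.fract (x n) - 1 with hy
    have hyabs : |y| ≤ 1 / (16 * (K : ℝ)) := by
      rw [abs_le]; constructor
      · linarith
      · have : 0 < 1 / (16 * (K : ℝ)) := by positivity
        linarith
    have hDy : D n = ∑ k ∈ Finset.range K, e (k * y) := by
      apply Finset.sum_congr rfl
      intro k _
      have h1 := e_fract k (x n)
      rw [Int.cast_natCast] at h1
      rw [← h1, ← e_sub_int _ (k : ℤ)]
      congr 1
      rw [hy]; push_cast; ring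
    have hdist : ‖D n - K‖ ≤ K / 2 := by
      have : D n - K = ∑ k ∈ Finset.range K, (e (k * y) - 1) := by
        rw [hDy, Finset.sum_sub_distrib]; simp
      rw [this]
      refine (norm_sum_le _ _).trans ?_
      have : ∀ k ∈ Finset.range K, ‖e (k * y) - 1‖ ≤ 1 / 2 := by
        intro k hk
        rw [Finset.mem_range] at hk
        refine (e_sub_one_le _).trans ?_
        rw [abs_mul, abs_of_nonneg (by positivity : (0:ℝ) ≤ k)]
        have hk' : (k : ℝ) ≤ K := by exact_mod_cast hk.le
        have h16 : (k : ℝ) * |y| ≤ 1 / 16 := by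
          calc (k : ℝ) * |y| ≤ K * (1 / (16 * (K : ℝ))) := by gcongr
            _ = 1 / 16 := by field_simp
        have := Real.pi_lt_four
        have := Real.pi_pos
        nlinarith
      refine (Finset.sum_le_sum this).trans ?_
      simp
      linarith
    have hDn : (K : ℝ) / 2 ≤ ‖D n‖ := by
      have h1 := norm_sub_norm_le (K : ℂ) (D n)
      rw [norm_sub_rev, Complex.norm_natCast] at h1
      linarith
    calc (K : ℝ) ^ 2 / 4 = ((K : ℝ) / 2) ^ 2 := by ring
      _ ≤ _ := by gcongr
  have hup : ∑ n ∈ s, ‖D n‖ ^ 2 ≤ K * s.card + (K : ℝ) ^ 2 * T := by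
    have h1 : ((∑ n ∈ s, ‖D n‖ ^ 2 : ℝ) : ℂ) =
        ∑ k ∈ Finset.range K, ∑ l ∈ Finset.range K, ∑ n ∈ s, e (((k : ℤ) - (l : ℤ) : ℤ) * x n) := by
      push_cast
      have : ∀ n ∈ s, ((‖D n‖ : ℂ)) ^ 2 = ∑ k ∈ Finset.range K, ∑ l ∈ Finset.range K,
          e (((k : ℤ) - (l : ℤ) : ℤ) * x n) := by
        intro n _
        rw [← Complex.mul_conj', hD]
        simp only [map_sum]
        rw [Finset.sum_mul_sum]
        refine Finset.sum_congr rfl fun k _ => Finset.sum_congr rfl fun l _ => ?_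
        rw [← e_neg, ← e_add]
        congr 1; push_cast; ring
      rw [Finset.sum_congr rfl this, Finset.sum_comm]
      simp only [Int.cast_sub, Int.cast_natCast]
      refine Finset.sum_congr rfl fun k _ => ?_
      rw [Finset.sum_comm]
    have h0 : 0 ≤ ∑ n ∈ s, ‖D n‖ ^ 2 := Finset.sum_nonneg fun _ _ => by positivity
    rw [← Real.norm_of_nonneg h0, ← Complex.norm_real, h1]
    refine (norm_sum_le _ _).trans ?_
    have h2 : ∀ k ∈ Finset.range K, ‖∑ l ∈ Finset.range K, ∑ n ∈ s, e (((k : ℤ) - (l : ℤ) : ℤ) * x n)‖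
        ≤ s.card + K * T := by
      intro k hk
      refine (norm_sum_le _ _).trans ?_
      have h3 : ∀ l ∈ Finset.range K, ‖∑ n ∈ s, e (((k : ℤ) - (l : ℤ) : ℤ) * x n)‖ ≤
          (if k = l then (s.card : ℝ) else 0) + T := by
        intro l hl
        rw [Finset.mem_range] at hk hl
        split_ifs with hkl
        · subst hkl
          simp [e_zero, hT]
        · rw [zero_add]
          refine h _ (by omega) ?_
          rw [abs_lt]; constructor <;> omega
      refine (Finset.sum_le_sum h3).trans ?_
      rw [Finset.sum_add_distrib, Finset.sum_ite_eq, if_pos hk]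
      simp
    refine (Finset.sum_le_sum h2).trans (le_of_eq ?_)
    simp
    ring
  have h5 : (((s.filter (fun n => 1 - 1 / (16 * (K : ℝ)) < Int.fract (x n))).card : ℕ) : ℝ) *
      ((K : ℝ) ^ 2 / 4) ≤ K * s.card + (K : ℝ) ^ 2 * T := by
    refine le_trans ?_ hup
    rw [← nsmul_eq_mul]
    refine (Finset.card_nsmul_le_sum _ _ _ hlow).trans ?_
    exact Finset.sum_le_sum_of_subset_of_nonneg (Finset.filter_subset _ _) fun _ _ _ => by positivity
  have h6 : (4 * (s.card / K + T)) * ((K : ℝ) ^ 2 / 4) = K * s.card + (K : ℝ) ^ 2 * T := by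
    field_simp
  rw [← h6] at h5
  exact le_of_mul_le_mul_right h5 (by positivity)

set_option maxHeartbeats 1000000 in
lemma partial_bound (c : ℝ) (hc1 : 1 < c) (hc2 : c < 2) :
    ∃ C > (0 : ℝ), ∀ (lam ξ : ℝ) (a b K : ℕ), lam ≠ 0 → |lam| ≤ 1 / 2 → 1 ≤ a → a ≤ b →
      b ≤ 4 * a + 1 → 1 ≤ K →
      ‖∑ n ∈ Finset.Ico a b, e (lam * (⌊(n : ℝ) ^ c⌋ : ℝ) - ξ * n)‖ ≤
        C * ((a : ℝ) / K + K * (a : ℝ) ^ (c / 2) + (a : ℝ) ^ (1 - c / 2) / √|lam|) := by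
  obtain ⟨C, hC, hS⟩ := S_bound c hc1 hc2
  have hZs : Summable fun m : ℤ => |(m : ℝ)| ^ (-(3 / 2) : ℝ) :=
    Real.summable_abs_int_rpow (by norm_num)
  set Z := ∑' m : ℤ, |(m : ℝ)| ^ (-(3 / 2) : ℝ) with hZ
  have hZ0 : 0 ≤ Z := tsum_nonneg fun m => by positivity
  refine ⟨64 + 32 * C + 3 * C + 64 * C * Z, by positivity, ?_⟩
  intro lam ξ a b K hlam hlam2 ha hab hb hK
  have ha' : (1 : ℝ) ≤ a := by exact_mod_cast ha
  have ha0 : (0 : ℝ) < a := by linarith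
  have hK' : (1 : ℝ) ≤ K := by exact_mod_cast hK
  have hK0 : (0 : ℝ) < K := by linarith
  have hba : (b : ℝ) - a ≤ 4 * a := by
    have : (b : ℝ) ≤ 4 * a + 1 := by exact_mod_cast hb
    linarith
  set P := (a : ℝ) ^ (c / 2) with hP
  have hP0 : 0 < P := by positivity
  set Q := (a : ℝ) ^ (1 - c / 2) with hQ
  have hQ0 : 0 < Q := by positivity
  have hQP : Q ≤ P := Real.rpow_le_rpow_of_exponent_le ha' (by linarith)
  have hδ0 : 0 < 1 / (16 * (K : ℝ)) := by positivity
  have hδ1 : 1 / (16 * (K : ℝ)) < 1 := by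
    rw [div_lt_one (by positivity)]; linarith
  obtain ⟨ch, F, hch0, hchm, hF, hFb, hFe⟩ := fourier_approx lam (1 / (16 * (K : ℝ))) hlam2 hδ0 hδ1
  -- bad set
  set bad := (Finset.Ico a b).filter (fun n : ℕ => 1 - 1 / (16 * (K : ℝ)) < Int.fract ((n : ℝ) ^ c)) with hbad
  have hbadc : (bad.card : ℝ) ≤ 4 * (4 * a / K + 2 * C * (K * P)) := by
    have := bad_count (Finset.Ico a b) (fun n => (n : ℝ) ^ c) K hK (2 * C * (K * P)) (by positivity) (by
      intro m hm hmK
      have h1 := hS m 0 a b (by exact_mod_cast hm) ha hab hb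
      simp only [zero_mul, sub_zero] at h1
      refine h1.trans ?_
      have hm1 : (1 : ℝ) ≤ |(m : ℝ)| := by exact_mod_cast Int.one_le_abs hm
      have hm2 : |(m : ℝ)| ≤ K := by exact_mod_cast hmK.le
      have hs1 : (1 : ℝ) ≤ √|(m : ℝ)| := Real.one_le_sqrt.2 hm1
      have hs2 : √|(m : ℝ)| ≤ K := by
        rw [Real.sqrt_le_left hK0.le]; nlinarith
      have h2 : Q / √|(m : ℝ)| ≤ K * P := by
        rw [div_le_iff₀ (by linarith)]
        have : P ≤ K * P := by nlinarith
        have : 0 < K * P := by positivity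
        nlinarith
      have h3 : √|(m : ℝ)| * P ≤ K * P := by gcongr
      nlinarith)
    refine this.trans ?_
    rw [Nat.card_Ico, Nat.cast_sub hab]
    gcongr
  -- decomposition
  set G : ℕ → ℂ := fun n => e (lam * (n : ℝ) ^ c - ξ * n) * F ((n : ℝ) ^ c) with hG
  have hdiff : ‖∑ n ∈ Finset.Ico a b, e (lam * (⌊(n : ℝ) ^ c⌋ : ℝ) - ξ * n) - ∑ n ∈ Finset.Ico a b, G n‖
      ≤ 4 * bad.card := by
    rw [← Finset.sum_sub_distrib]
    refine (norm_sum_le _ _).trans ?_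
    have : ∀ n ∈ Finset.Ico a b, ‖e (lam * (⌊(n : ℝ) ^ c⌋ : ℝ) - ξ * n) - G n‖ ≤
        if 1 - 1 / (16 * (K : ℝ)) < Int.fract ((n : ℝ) ^ c) then 4 else 0 := by
      intro n _
      split_ifs with hh
      · refine (norm_sub_le _ _).trans ?_
        simp only [hG]
        rw [norm_mul, e_norm, e_norm]
        linarith [hFb ((n : ℝ) ^ c)]
      · simp only [hG]
        rw [hFe _ (not_lt.1 hh), ← e_add]
        have : lam * (n : ℝ) ^ c - ξ * n + -lam * Int.fract ((n : ℝ) ^ c) =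
          lam * (⌊(n : ℝ) ^ c⌋ : ℝ) - ξ * n := by
          rw [Int.fract]; ring
        rw [this]; simp
    refine (Finset.sum_le_sum this).trans (le_of_eq ?_)
    rw [← Finset.sum_filter, Finset.sum_const, nsmul_eq_mul, mul_comm]
  have hGs : HasSum (fun m : ℤ => ch m * ∑ n ∈ Finset.Ico a b, e ((lam + m) * (n : ℝ) ^ c - ξ * n))
      (∑ n ∈ Finset.Ico a b, G n) := by
    have := hasSum_sum (s := Finset.Ico a b) (f := fun (n : ℕ) (m : ℤ) =>
      e (lam * (n : ℝ) ^ c - ξ * n) * (ch m * e (m * (n : ℝ) ^ c))) (a := G)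
      (fun n _ => (hF ((n : ℝ) ^ c)).mul_left _)
    refine this.congr_fun ?_
    intro m
    rw [Finset.mul_sum]
    refine Finset.sum_congr rfl fun n _ => ?_
    rw [show (lam + m) * (n : ℝ) ^ c - ξ * n = (lam * (n : ℝ) ^ c - ξ * n) + m * (n : ℝ) ^ c by ring,
      e_add]
    ring
  set X := 3 * (C * (√|lam| * P + Q / √|lam|)) with hX
  have hbs : HasSum (fun m : ℤ => (if m = 0 then X else 0) +
      (64 * C * K * P) * |(m : ℝ)| ^ (-(3 / 2) : ℝ)) (X + (64 * C * K * P) * Z) :=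
    (hasSum_ite_eq 0 X).add (hZs.hasSum.mul_left _)
  have hmain : ‖∑ n ∈ Finset.Ico a b, G n‖ ≤ X + (64 * C * K * P) * Z := by
    refine hGs.norm_le_of_bounded hbs ?_
    intro m
    rw [norm_mul]
    split_ifs with hm
    · subst hm
      have h1 := hS lam ξ a b hlam ha hab hb
      have h2 : (0 : ℝ) ≤ (64 * C * K * P) * |((0 : ℤ) : ℝ)| ^ (-(3 / 2) : ℝ) := by positivity
      refine le_trans ?_ (le_add_of_nonneg_right h2)
      simp only [Int.cast_zero, add_zero]
      rw [hX]
      gcongr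
    · rw [zero_add]
      have hm1 : (1 : ℝ) ≤ |(m : ℝ)| := by exact_mod_cast Int.one_le_abs hm
      have hth : |(m : ℝ)| / 2 ≤ |lam + m| := by
        have := abs_sub_abs_le_abs_sub (m : ℝ) (-lam)
        rw [abs_neg, sub_neg_eq_add, add_comm] at this
        linarith
      have hth2 : |lam + m| ≤ 4 * |(m : ℝ)| := by
        have := abs_add_le lam (m : ℝ)
        linarith
      have hne : lam + m ≠ 0 := by
        rw [← abs_pos]; linarith
      have h1 := hS (lam + m) ξ a b hne ha hab hb
      have hs0 : 0 < √|(m : ℝ)| := Real.sqrt_pos.2 (by linarith)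
      have hs1 : 1 ≤ √|(m : ℝ)| := Real.one_le_sqrt.2 hm1
      have hss : √|(m : ℝ)| * √|(m : ℝ)| = |(m : ℝ)| := Real.mul_self_sqrt (abs_nonneg _)
      have hr1 : √|lam + m| ≤ 2 * √|(m : ℝ)| := by
        rw [Real.sqrt_le_left (by positivity)]; nlinarith
      have hr2 : 1 / 2 ≤ √|lam + m| := by
        apply Real.le_sqrt_of_sq_le; nlinarith
      have h2 : √|lam + m| * P + Q / √|lam + m| ≤ 4 * √|(m : ℝ)| * P := by
        have e1 : √|lam + m| * P ≤ 2 * √|(m : ℝ)| * P := by gcongr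
        have e2 : Q / √|lam + m| ≤ P / (1 / 2) := by gcongr
        have e3 : P ≤ √|(m : ℝ)| * P := by nlinarith
        have e4 : P / (1 / 2) = 2 * P := by ring
        linarith
      have h3 : |(m : ℝ)| ^ (-(3 / 2) : ℝ) = √|(m : ℝ)| / (m : ℝ) ^ 2 := by
        rw [Real.sqrt_eq_rpow, ← sq_abs (m : ℝ), ← Real.rpow_natCast, ← Real.rpow_sub (by linarith)]
        norm_num
      have hm2 : 0 < (m : ℝ) ^ 2 := by rw [← sq_abs]; nlinarith
      calc ‖ch m‖ * ‖∑ n ∈ Finset.Ico a b, e ((lam + m) * (n : ℝ) ^ c - ξ * n)‖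
          ≤ (1 / (1 / (16 * (K : ℝ)) * (m : ℝ) ^ 2)) * (C * (4 * √|(m : ℝ)| * P)) := by
            gcongr
            · exact hchm m hm
            · exact h1.trans (by gcongr)
        _ = _ := by
            rw [h3]
            generalize √|(m : ℝ)| = r at *
            field_simp
            norm_num
  have htri : ‖∑ n ∈ Finset.Ico a b, e (lam * (⌊(n : ℝ) ^ c⌋ : ℝ) - ξ * n)‖ ≤
      4 * bad.card + (X + (64 * C * K * P) * Z) := by
    have := norm_le_norm_sub_add (∑ n ∈ Finset.Ico a b, e (lam * (⌊(n : ℝ) ^ c⌋ : ℝ) - ξ * n))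
      (∑ n ∈ Finset.Ico a b, G n)
    linarith
  refine htri.trans ?_
  have hl1 : √|lam| ≤ 1 := Real.sqrt_le_one.2 (by linarith)
  have hl0 : 0 < √|lam| := Real.sqrt_pos.2 (abs_pos.2 hlam)
  have f1 : √|lam| * P ≤ K * P := by gcongr; linarith
  have f2 : 4 * (a : ℝ) / K = 4 * ((a : ℝ) / K) := by ring
  rw [f2] at hbadc
  set R := Q / √|lam| with hR
  have hR0 : 0 < R := by positivity
  have hU0 : 0 < (a : ℝ) / K := by positivity
  generalize (a : ℝ) / K = U at *
  have hV0 : 0 < K * P := by positivity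
  rw [show 64 * C * K * P * Z = 64 * C * Z * (K * P) by ring, hX]
  generalize (K : ℝ) * P = V at *
  have g1 : C * (√|lam| * P + R) ≤ C * (V + R) := by gcongr
  have hCZ : 0 ≤ C * Z := by positivity
  have k1 : 0 ≤ C * U := by positivity
  have k2 : 0 ≤ C * R := by positivity
  have k3 : 0 ≤ C * Z * U := by positivity
  have k4 : 0 ≤ C * Z * R := by positivity
  have k5 : 0 ≤ C * V := by positivity
  nlinarith

lemma sbp (w z : ℕ → ℂ) (a b : ℕ) (hab : a ≤ b) (B W V : ℝ) (hB : 0 ≤ B)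
    (h1 : ∀ m, a ≤ m → m ≤ b → ‖∑ n ∈ Finset.Ico a m, z n‖ ≤ B) (h2 : ‖w b‖ ≤ W)
    (h3 : ∑ n ∈ Finset.Ico a b, ‖w (n + 1) - w n‖ ≤ V) :
    ‖∑ n ∈ Finset.Ico a b, z n * w n‖ ≤ (W + V) * B := by
  set T : ℕ → ℂ := fun m => ∑ n ∈ Finset.Ico a m, z n with hT
  have hk : ∀ n ∈ Finset.Ico a b, z n * w n =
      (w (n + 1) * T (n + 1) - w n * T n) - (w (n + 1) - w n) * T (n + 1) := by
    intro n hn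
    rw [Finset.mem_Ico] at hn
    have : T (n + 1) = T n + z n := by
      simp only [hT]; rw [Finset.sum_Ico_succ_top hn.1]
    rw [this]; ring
  rw [Finset.sum_congr rfl hk, Finset.sum_sub_distrib,
    Finset.sum_Ico_sub (fun n => w n * T n) hab]
  have hTa : T a = 0 := by simp [hT]
  rw [hTa, mul_zero, sub_zero]
  refine (norm_sub_le _ _).trans ?_
  rw [add_mul]
  apply add_le_add
  · rw [norm_mul]
    exact mul_le_mul h2 (h1 b hab le_rfl) (norm_nonneg _) ((norm_nonneg _).trans h2)
  · refine (norm_sum_le _ _).trans ?_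
    calc _ ≤ ∑ n ∈ Finset.Ico a b, ‖w (n + 1) - w n‖ * B := by
          apply Finset.sum_le_sum
          intro n hn
          rw [Finset.mem_Ico] at hn
          rw [norm_mul]
          gcongr
          exact h1 (n + 1) (by omega) (by omega)
      _ ≤ _ := by rw [← Finset.sum_mul]; gcongr

lemma geom_bound (ξ : ℝ) (h0 : ξ ≠ 0) (h : |ξ| ≤ 1 / 2) (a m : ℕ) (ham : a ≤ m) :
    ‖∑ n ∈ Finset.Ico a m, e (-ξ * n)‖ ≤ 1 / |ξ| := by
  have hge := e_sub_one_ge (-ξ) (by rwa [abs_neg])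
  rw [abs_neg] at hge
  have hx : 0 < |ξ| := abs_pos.2 h0
  have hk : (e (-ξ) - 1) * ∑ n ∈ Finset.Ico a m, e (-ξ * n) = e (-ξ * m) - e (-ξ * a) := by
    rw [← Finset.sum_Ico_sub (fun n : ℕ => e (-ξ * n)) ham, Finset.mul_sum]
    refine Finset.sum_congr rfl fun n _ => ?_
    rw [sub_mul, ← e_add, one_mul]
    congr 2
    push_cast; ring
  have hn : ‖e (-ξ) - 1‖ * ‖∑ n ∈ Finset.Ico a m, e (-ξ * n)‖ ≤ 2 := by
    rw [← norm_mul, hk]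
    refine (norm_sub_le _ _).trans ?_
    rw [e_norm, e_norm]; norm_num
  rw [le_div_iff₀ hx]
  nlinarith [norm_nonneg (∑ n ∈ Finset.Ico a m, e (-ξ * n))]

/-- analytic core: weights `ψ` supported in `[a, 4a]` with bounded variation -/
lemma core (c ε L : ℝ) (hc1 : 1 < c) (hc2 : c < 2) (hε1 : 0 < ε) (hε2 : ε < 2 - c) (hL : 0 ≤ L) :
    ∃ C > (0 : ℝ), ∀ (a : ℕ) (A ξ lam : ℝ) (ψ : ℕ → ℝ), 1 ≤ a → A = 8 * a →
      |ξ| ≤ 1 / 2 → |lam| ≤ 1 / 2 → ¬ (|ξ| ≤ A ^ (2 * ε - 1) ∧ |lam| ≤ A ^ (ε - c)) →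
      (∀ n, a ≤ n → |ψ n| ≤ 1 / a) → (∀ n, a ≤ n → |ψ (n + 1) - ψ n| ≤ L / (a : ℝ) ^ 2) →
      ‖∑ n ∈ Finset.Ico a (4 * a + 1), e (lam * (⌊(n : ℝ) ^ c⌋ : ℝ) - ξ * n) * (ψ n : ℂ)‖ ≤
        C * A ^ (-(ε / 4)) := by
  obtain ⟨C, hC, hPB⟩ := partial_bound c hc1 hc2
  refine ⟨8 * (1 + 4 * L) * (4 * C) + 8 * (8 + 4 * L), by positivity, ?_⟩
  intro a A ξ lam ψ ha hA hξ hlam hmaj hψ1 hψ2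
  have ha' : (1 : ℝ) ≤ a := by exact_mod_cast ha
  have ha0 : (0 : ℝ) < a := by linarith
  have hA1 : 1 ≤ A := by linarith
  have hA0 : 0 < A := by linarith
  have haA : (a : ℝ) ≤ A := by linarith
  have hvar : ∑ n ∈ Finset.Ico a (4 * a + 1), |ψ (n + 1) - ψ n| ≤ 4 * L / a := by
    have : ∀ n ∈ Finset.Ico a (4 * a + 1), |ψ (n + 1) - ψ n| ≤ L / (a : ℝ) ^ 2 := by
      intro n hn
      rw [Finset.mem_Ico] at hn
      exact hψ2 n hn.1
    refine (Finset.sum_le_sum this).trans ?_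
    rw [Finset.sum_const, Nat.card_Ico, nsmul_eq_mul]
    have h4 : ((4 * a + 1 - a : ℕ) : ℝ) ≤ 4 * a := by exact_mod_cast (by omega : 4 * a + 1 - a ≤ 4 * a)
    calc _ ≤ 4 * (a : ℝ) * (L / (a : ℝ) ^ 2) := by gcongr
      _ = _ := by field_simp
  have hψb : |ψ (4 * a + 1)| ≤ 1 / a := hψ1 _ (by omega)
  have ha8 : 1 / (a : ℝ) = 8 / A := by rw [hA]; field_simp
  by_cases hl : |lam| ≤ A ^ (ε - c)
  · -- small `lam`, large `ξ`
    have hξ2 : A ^ (2 * ε - 1) < |ξ| := by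
      by_contra hcon
      exact hmaj ⟨not_lt.1 hcon, hl⟩
    have hξ0 : ξ ≠ 0 := by
      rw [← abs_pos]; exact lt_trans (by positivity) hξ2
    set w : ℕ → ℂ := fun n => e (lam * (⌊(n : ℝ) ^ c⌋ : ℝ)) * (ψ n : ℂ) with hw
    have hfl : ∀ n : ℕ, (⌊(n : ℝ) ^ c⌋ : ℝ) ≤ (⌊((n + 1 : ℕ) : ℝ) ^ c⌋ : ℝ) := by
      intro n
      have : ⌊(n : ℝ) ^ c⌋ ≤ ⌊((n + 1 : ℕ) : ℝ) ^ c⌋ := by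
        apply Int.floor_mono
        apply Real.rpow_le_rpow (by positivity) _ (by linarith)
        push_cast; linarith
      exact_mod_cast this
    have hV : ∑ n ∈ Finset.Ico a (4 * a + 1), ‖w (n + 1) - w n‖ ≤ 7 * A ^ ε / a + 4 * L / a := by
      have h1 : ∀ n ∈ Finset.Ico a (4 * a + 1), ‖w (n + 1) - w n‖ ≤
          (7 * |lam| / a) * ((⌊((n + 1 : ℕ) : ℝ) ^ c⌋ : ℝ) - (⌊(n : ℝ) ^ c⌋ : ℝ)) +
            |ψ (n + 1) - ψ n| := by
        intro n hn
        rw [Finset.mem_Ico] at hn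
        have h2 : w (n + 1) - w n = (e (lam * (⌊((n + 1 : ℕ) : ℝ) ^ c⌋ : ℝ)) -
            e (lam * (⌊(n : ℝ) ^ c⌋ : ℝ))) * (ψ n : ℂ) +
            e (lam * (⌊((n + 1 : ℕ) : ℝ) ^ c⌋ : ℝ)) * ((ψ (n + 1) - ψ n : ℝ) : ℂ) := by
          simp only [hw]; push_cast; ring
        rw [h2]
        refine (norm_add_le _ _).trans ?_
        rw [norm_mul, norm_mul, e_norm, one_mul, Complex.norm_real, Complex.norm_real,
          Real.norm_eq_abs, Real.norm_eq_abs]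
        refine add_le_add ?_ le_rfl
        have h3 := e_sub_le (lam * (⌊((n + 1 : ℕ) : ℝ) ^ c⌋ : ℝ)) (lam * (⌊(n : ℝ) ^ c⌋ : ℝ))
        have hd : 0 ≤ (⌊((n + 1 : ℕ) : ℝ) ^ c⌋ : ℝ) - (⌊(n : ℝ) ^ c⌋ : ℝ) := sub_nonneg.2 (hfl n)
        rw [← mul_sub, abs_mul, abs_of_nonneg hd] at h3
        have hpi := Real.pi_lt_d2
        calc _ ≤ (7 * (|lam| * ((⌊((n + 1 : ℕ) : ℝ) ^ c⌋ : ℝ) - (⌊(n : ℝ) ^ c⌋ : ℝ)))) * (1 / a) := by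
              gcongr
              · refine h3.trans ?_
                gcongr
                linarith
              · exact hψ1 n hn.1
          _ = _ := by ring
      refine (Finset.sum_le_sum h1).trans ?_
      rw [Finset.sum_add_distrib, ← Finset.mul_sum,
        Finset.sum_Ico_sub (fun n : ℕ => (⌊(n : ℝ) ^ c⌋ : ℝ)) (by omega : a ≤ 4 * a + 1)]
      apply add_le_add _ hvar
      have h5 : (⌊((4 * a + 1 : ℕ) : ℝ) ^ c⌋ : ℝ) - (⌊(a : ℝ) ^ c⌋ : ℝ) ≤ A ^ c := by
        have h6 : (0 : ℝ) ≤ (⌊(a : ℝ) ^ c⌋ : ℝ) := by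
          exact_mod_cast Int.floor_nonneg.2 (by positivity : (0 : ℝ) ≤ (a : ℝ) ^ c)
        have h7 : (⌊((4 * a + 1 : ℕ) : ℝ) ^ c⌋ : ℝ) ≤ ((4 * a + 1 : ℕ) : ℝ) ^ c := Int.floor_le _
        have h8 : ((4 * a + 1 : ℕ) : ℝ) ^ c ≤ A ^ c := by
          apply Real.rpow_le_rpow (by positivity) _ (by linarith)
          push_cast; linarith
        linarith
      have h9 : A ^ (ε - c) * A ^ c = A ^ ε := by
        rw [← Real.rpow_add hA0]; congr 1; ring
      calc _ ≤ (7 * |lam| / a) * A ^ c := mul_le_mul_of_nonneg_left h5 (by positivity)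
        _ ≤ (7 * A ^ (ε - c) / a) * A ^ c := by gcongr
        _ = _ := by rw [← h9]; ring
    have hmain := sbp w (fun n => e (-ξ * n)) a (4 * a + 1) (by omega) (1 / |ξ|) (1 / a)
      (7 * A ^ ε / a + 4 * L / a) (by positivity) (fun m hm _ => geom_bound ξ hξ0 hξ a m hm)
      (by simp only [hw]; rw [norm_mul, e_norm, one_mul, Complex.norm_real]; exact hψb) hV
    have heq : ∑ n ∈ Finset.Ico a (4 * a + 1), e (lam * (⌊(n : ℝ) ^ c⌋ : ℝ) - ξ * n) * (ψ n : ℂ) =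
        ∑ n ∈ Finset.Ico a (4 * a + 1), e (-ξ * n) * w n := by
      refine Finset.sum_congr rfl fun n _ => ?_
      simp only [hw]
      rw [← mul_assoc, ← e_add]
      congr 2; ring
    rw [heq]
    refine hmain.trans ?_
    have hAε : 1 ≤ A ^ ε := Real.one_le_rpow hA1 hε1.le
    have i1 : 1 / (a : ℝ) + (7 * A ^ ε / a + 4 * L / a) ≤ 8 * (8 + 4 * L) * (A ^ ε * A⁻¹) := by
      have : 1 / (a : ℝ) + (7 * A ^ ε / a + 4 * L / a) = (1 + 7 * A ^ ε + 4 * L) * (1 / a) := by ring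
      rw [this, ha8]
      have : 1 + 7 * A ^ ε + 4 * L ≤ (8 + 4 * L) * A ^ ε := by nlinarith
      calc _ ≤ (8 + 4 * L) * A ^ ε * (8 / A) := by gcongr
        _ = _ := by ring
    have i2 : 1 / |ξ| ≤ A ^ (1 - 2 * ε) := by
      rw [show 1 - 2 * ε = -(2 * ε - 1) by ring, Real.rpow_neg hA0.le, ← one_div]
      gcongr
    have i3 : A ^ ε * A⁻¹ * A ^ (1 - 2 * ε) = A ^ (-ε) := by
      rw [← Real.rpow_neg_one A, ← Real.rpow_add hA0, ← Real.rpow_add hA0]; congr 1; ring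
    have i4 : A ^ (-ε) ≤ A ^ (-(ε / 4)) := Real.rpow_le_rpow_of_exponent_le hA1 (by linarith)
    calc _ ≤ (8 * (8 + 4 * L) * (A ^ ε * A⁻¹)) * A ^ (1 - 2 * ε) := by gcongr
      _ = 8 * (8 + 4 * L) * A ^ (-ε) := by rw [← i3]; ring
      _ ≤ 8 * (8 + 4 * L) * A ^ (-(ε / 4)) := by gcongr
      _ ≤ _ := by
        gcongr
        have : 0 ≤ 8 * (1 + 4 * L) * (4 * C) := by positivity
        linarith
  · -- large `lam`
    rw [not_le] at hl
    have hlam0 : lam ≠ 0 := by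
      rw [← abs_pos]; exact lt_trans (by positivity) hl
    set K := ⌈A ^ (ε / 4)⌉₊ with hK
    have hx1 : 1 ≤ A ^ (ε / 4) := Real.one_le_rpow hA1 (by linarith)
    have hK1 : A ^ (ε / 4) ≤ K := Nat.le_ceil _
    have hK2 : (K : ℝ) ≤ 2 * A ^ (ε / 4) := by
      have := Nat.ceil_lt_add_one (show 0 ≤ A ^ (ε / 4) by positivity)
      linarith
    have hKn : 1 ≤ K := by
      have : (1 : ℝ) ≤ K := hx1.trans hK1
      exact_mod_cast this
    have hbnd : (a : ℝ) / K + K * (a : ℝ) ^ (c / 2) + (a : ℝ) ^ (1 - c / 2) / √|lam| ≤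
        4 * A ^ (1 - ε / 4) := by
      have t1 : (a : ℝ) / K ≤ A ^ (1 - ε / 4) := by
        rw [Real.rpow_sub hA0, Real.rpow_one]; gcongr
      have t2 : K * (a : ℝ) ^ (c / 2) ≤ 2 * A ^ (1 - ε / 4) := by
        calc _ ≤ 2 * A ^ (ε / 4) * A ^ (c / 2) := by gcongr
          _ = 2 * A ^ (ε / 4 + c / 2) := by rw [Real.rpow_add hA0]; ring
          _ ≤ _ := by
            gcongr
            linarith
      have t3 : (a : ℝ) ^ (1 - c / 2) / √|lam| ≤ A ^ (1 - ε / 4) := by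
        have h1 : A ^ ((ε - c) / 2) ≤ √|lam| := by
          apply Real.le_sqrt_of_sq_le
          rw [← Real.rpow_natCast, ← Real.rpow_mul hA0.le]
          refine le_trans (le_of_eq ?_) hl.le
          congr 1; push_cast; ring
        calc _ ≤ A ^ (1 - c / 2) / A ^ ((ε - c) / 2) := by
              gcongr
              linarith
          _ = A ^ (1 - ε / 2) := by rw [← Real.rpow_sub hA0]; congr 1; ring
          _ ≤ _ := Real.rpow_le_rpow_of_exponent_le hA1 (by linarith)
      linarith
    have hmain := sbp (fun n => (ψ n : ℂ)) (fun n => e (lam * (⌊(n : ℝ) ^ c⌋ : ℝ) - ξ * n)) a (4 * a + 1)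
      (by omega) (C * (4 * A ^ (1 - ε / 4))) (1 / a) (4 * L / a) (by positivity)
      (fun m hm hm' => (hPB lam ξ a m K hlam0 hlam ha hm hm' hKn).trans (by gcongr))
      (by rw [Complex.norm_real]; exact hψb)
      (by
        refine le_trans (le_of_eq ?_) hvar
        refine Finset.sum_congr rfl fun n _ => ?_
        rw [← Complex.ofReal_sub, Complex.norm_real, Real.norm_eq_abs])
    refine hmain.trans ?_
    have i1 : 1 / (a : ℝ) + 4 * L / a = 8 * (1 + 4 * L) * A⁻¹ := by
      rw [hA]; field_simp
    have i3 : A⁻¹ * A ^ (1 - ε / 4) = A ^ (-(ε / 4)) := by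
      rw [← Real.rpow_neg_one A, ← Real.rpow_add hA0]; congr 1; ring
    rw [i1]
    calc _ = 8 * (1 + 4 * L) * (4 * C) * (A⁻¹ * A ^ (1 - ε / 4)) := by ring
      _ = 8 * (1 + 4 * L) * (4 * C) * A ^ (-(ε / 4)) := by rw [i3]
      _ ≤ _ := by
        gcongr
        have : 0 ≤ 8 * (8 + 4 * L) := by positivity
        linarith

lemma psi_eq (φ : ℝ → ℝ) (j : ℕ) (x : ℝ) :
    psi φ j x = (φ (x / 2 ^ j) - φ (2 * x / 2 ^ j)) / x := by
  have h1 : (2 : ℝ) ^ (-(j : ℝ)) = ((2 : ℝ) ^ j)⁻¹ := by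
    rw [Real.rpow_neg (by norm_num), Real.rpow_natCast]
  unfold psi
  rw [Real.rpow_add (by norm_num), h1, Real.rpow_one]
  congr 3
  · ring_nf
  · ring_nf

lemma psi_odd (φ : ℝ → ℝ) (hφeven : ∀ x, φ (-x) = φ x) (j : ℕ) (x : ℝ) :
    psi φ j (-x) = -psi φ j x := by
  rw [psi_eq, psi_eq, neg_div, hφeven, mul_neg, neg_div, hφeven, div_neg]

lemma mj_eq (φ : ℝ → ℝ) (hφeven : ∀ x, φ (-x) = φ x) (hz : ∀ x, 1 / 2 < x → φ x = 0)
    (c : ℝ) (j : ℕ) (ξ lam : ℝ) :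
    mj φ c j ξ lam =
      ∑ n ∈ Finset.Ico (1 : ℕ) (2 ^ j + 1), e (lam * (⌊(n : ℝ) ^ c⌋ : ℝ) - ξ * n) * (psi φ j n : ℂ) -
      ∑ n ∈ Finset.Ico (1 : ℕ) (2 ^ j + 1), e (lam * (⌊(n : ℝ) ^ c⌋ : ℝ) - (-ξ) * n) * (psi φ j n : ℂ) := by
  have hp : ∀ n : ℕ, n ∉ Finset.range (2 ^ j) → psi φ j ((n : ℝ) + 1) = 0 := by
    intro n hn
    rw [Finset.mem_range, not_lt] at hn
    have hn' : (2 : ℝ) ^ j ≤ n := by exact_mod_cast hn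
    have h2 : (0 : ℝ) < 2 ^ j := by positivity
    rw [psi_eq, hz, hz]
    · simp
    · rw [lt_div_iff₀ h2]; linarith
    · rw [lt_div_iff₀ h2]; linarith
  set f : ℤ → ℂ := fun n : ℤ => if n = 0 then 0 else
    e (lam * (⌊|(n : ℝ)| ^ c⌋ : ℝ) - ξ * (n : ℝ)) * (psi φ j (n : ℝ) : ℂ) with hf
  have hf1 : ∀ n : ℕ, f ((n : ℤ) + 1) =
      e (lam * (⌊((n : ℝ) + 1) ^ c⌋ : ℝ) - ξ * ((n : ℝ) + 1)) * (psi φ j ((n : ℝ) + 1) : ℂ) := by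
    intro n
    have h0 : (n : ℤ) + 1 ≠ 0 := by omega
    simp only [hf, if_neg h0]
    push_cast
    rw [abs_of_nonneg (by positivity : (0 : ℝ) ≤ (n : ℝ) + 1)]
  have hf2 : ∀ n : ℕ, f (-((n : ℤ) + 1)) =
      -(e (lam * (⌊((n : ℝ) + 1) ^ c⌋ : ℝ) - (-ξ) * ((n : ℝ) + 1)) * (psi φ j ((n : ℝ) + 1) : ℂ)) := by
    intro n
    have h0 : -((n : ℤ) + 1) ≠ 0 := by omega
    simp only [hf, if_neg h0]
    rw [Int.cast_neg, abs_neg, psi_odd φ hφeven]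
    push_cast
    rw [abs_of_nonneg (by positivity : (0 : ℝ) ≤ (n : ℝ) + 1), mul_neg, neg_mul_comm]
  have H1 : HasSum (fun n : ℕ => f ((n : ℤ) + 1)) (∑ n ∈ Finset.range (2 ^ j), f ((n : ℤ) + 1)) := by
    apply hasSum_sum_of_ne_finset_zero
    intro n hn
    rw [hf1, hp n hn]; simp
  have H2 : HasSum (fun n : ℕ => f (-((n : ℤ) + 1)))
      (∑ n ∈ Finset.range (2 ^ j), f (-((n : ℤ) + 1))) := by
    apply hasSum_sum_of_ne_finset_zero
    intro n hn
    rw [hf2, hp n hn]; simp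
  have H := (HasSum.of_add_one_of_neg_add_one H1 H2).tsum_eq
  have hf0 : f 0 = 0 := by simp [hf]
  have hm : mj φ c j ξ lam = ∑' n : ℤ, f n := rfl
  rw [hm, H, hf0, add_zero, sub_eq_add_neg, Finset.sum_Ico_eq_sum_range, Finset.sum_Ico_eq_sum_range,
    ← Finset.sum_neg_distrib]
  simp only [Nat.add_sub_cancel]
  congr 1
  · refine Finset.sum_congr rfl fun n _ => ?_
    rw [hf1]; push_cast; rw [add_comm (n : ℝ) 1]
  · refine Finset.sum_congr rfl fun n _ => ?_
    rw [hf2]; push_cast; rw [add_comm (n : ℝ) 1]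

theorem stmt3 (c ε : ℝ) (hc1 : 1 < c) (hc2 : c < 2)
    (hε1 : 0 < ε) (hε2 : ε < min (1/4) (2 - c))
    (φ : ℝ → ℝ) (hφsmooth : ContDiff ℝ (⊤ : ℕ∞) φ) (hφeven : ∀ x, φ (-x) = φ x)
    (hφlb : ∀ x, Set.indicator (Set.Icc (-(1/4) : ℝ) (1/4)) 1 x ≤ φ x)
    (hφub : ∀ x, φ x ≤ Set.indicator (Set.Icc (-(1/2) : ℝ) (1/2)) 1 x) :
    ∃ C > (0 : ℝ), ∀ (j : ℕ) (ξ lam : ℝ),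
      ξ ∈ Set.Ico (-(1/2) : ℝ) (1/2) → lam ∈ Set.Ico (-(1/2) : ℝ) (1/2) →
      ¬ (|ξ| ≤ (2 : ℝ) ^ ((2 * ε - 1) * (j : ℝ)) ∧
         |lam| ≤ (2 : ℝ) ^ ((ε - c) * (j : ℝ))) →
      ‖mj φ c j ξ lam‖ ≤ C * (2 : ℝ) ^ (-(ε / 4) * (j : ℝ)) := by
  obtain ⟨hε4, hεc⟩ := lt_min_iff.1 hε2
  have hnn : ∀ x, 0 ≤ φ x := fun x =>
    le_trans (Set.indicator_nonneg (fun _ _ => by simp) x) (hφlb x)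
  have hle1 : ∀ x, φ x ≤ 1 := fun x =>
    le_trans (hφub x) (Set.indicator_le_self' (fun _ _ => by simp) x)
  have hone : ∀ x, 0 ≤ x → x ≤ 1 / 4 → φ x = 1 := by
    intro x h0 h1
    refine le_antisymm (hle1 x) ?_
    have := hφlb x
    rwa [Set.indicator_of_mem (show x ∈ Set.Icc (-(1/4) : ℝ) (1/4) from ⟨by linarith, h1⟩)] at this
  have hout : ∀ x, x ∉ Set.Icc (-(1/2) : ℝ) (1/2) → φ x = 0 := by
    intro x hx
    refine le_antisymm ?_ (hnn x)
    have := hφub x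
    rwa [Set.indicator_of_notMem hx] at this
  have hz : ∀ x, 1 / 2 < x → φ x = 0 := fun x hx => hout x (fun h => by linarith [h.2])
  have hu : ∀ x y, |φ x - φ y| ≤ 1 := by
    intro x y
    rw [abs_le]
    constructor <;> linarith [hnn x, hnn y, hle1 x, hle1 y]
  obtain ⟨L0, hL0⟩ := ContDiff.lipschitzWith_of_hasCompactSupport
    (HasCompactSupport.intro isCompact_Icc hout) hφsmooth (by simp)
  have hlip : ∀ x y, |φ x - φ y| ≤ L0 * |x - y| := by
    intro x y
    have := hL0.dist_le_mul x y
    rwa [Real.dist_eq, Real.dist_eq] at this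
  have hpsi1 : ∀ (j : ℕ) (x : ℝ), 0 < x → |psi φ j x| ≤ 1 / x := by
    intro j x hx
    rw [psi_eq, abs_div, abs_of_pos hx]
    gcongr
    exact hu _ _
  obtain ⟨C, hC, hcore⟩ := core c ε (L0 + 1) hc1 hc2 hε1 hεc (by positivity)
  refine ⟨2 * C + 16, by positivity, ?_⟩
  intro j ξ lam hξ hlam hmaj
  have hξ' : |ξ| ≤ 1 / 2 := abs_le.2 ⟨by linarith [hξ.1], hξ.2.le⟩
  have hlam' : |lam| ≤ 1 / 2 := abs_le.2 ⟨by linarith [hlam.1], hlam.2.le⟩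
  rw [mj_eq φ hφeven hz]
  by_cases hj : j < 3
  · have hS : ∀ η : ℝ, ‖∑ n ∈ Finset.Ico (1 : ℕ) (2 ^ j + 1),
        e (lam * (⌊(n : ℝ) ^ c⌋ : ℝ) - η * n) * (psi φ j n : ℂ)‖ ≤ 4 := by
      intro η
      refine (norm_sum_le _ _).trans ?_
      have h1 : ∀ n ∈ Finset.Ico (1 : ℕ) (2 ^ j + 1),
          ‖e (lam * (⌊(n : ℝ) ^ c⌋ : ℝ) - η * n) * (psi φ j n : ℂ)‖ ≤ 1 := by
        intro n hn
        rw [Finset.mem_Ico] at hn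
        have hn1 : (1 : ℝ) ≤ n := by exact_mod_cast hn.1
        rw [norm_mul, e_norm, one_mul, Complex.norm_real, Real.norm_eq_abs]
        refine (hpsi1 j n (by linarith)).trans ?_
        rw [div_le_one (by linarith)]; exact hn1
      refine (Finset.sum_le_sum h1).trans ?_
      rw [Finset.sum_const, Nat.card_Ico, nsmul_eq_mul, mul_one, Nat.add_sub_cancel]
      have : 2 ^ j ≤ 2 ^ 2 := Nat.pow_le_pow_right (by norm_num) (by omega)
      exact_mod_cast this
    have hpow : (1 / 2 : ℝ) ≤ (2 : ℝ) ^ (-(ε / 4) * (j : ℝ)) := by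
      have h2 : (j : ℝ) ≤ 2 := by exact_mod_cast (by omega : j ≤ 2)
      rw [show (1 / 2 : ℝ) = (2 : ℝ) ^ (-1 : ℝ) by rw [Real.rpow_neg_one]; norm_num]
      apply Real.rpow_le_rpow_of_exponent_le (by norm_num)
      nlinarith
    refine (norm_sub_le _ _).trans ?_
    have := hS ξ
    have := hS (-ξ)
    nlinarith
  · obtain ⟨i, rfl⟩ : ∃ i, j = i + 3 := ⟨j - 3, by omega⟩
    set a : ℕ := 2 ^ i with ha
    have ha1 : 1 ≤ a := Nat.one_le_two_pow
    have ha1' : (1 : ℝ) ≤ a := by exact_mod_cast ha1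
    have ha0 : (0 : ℝ) < a := by linarith
    have hN : (2 : ℝ) ^ (i + 3) = 8 * a := by rw [ha]; push_cast; ring
    have hNn : 2 ^ (i + 3) = 8 * a := by rw [ha]; ring
    have hconv : ∀ p : ℝ, (2 : ℝ) ^ (p * ((i + 3 : ℕ) : ℝ)) = (8 * (a : ℝ)) ^ p := by
      intro p
      rw [mul_comm, Real.rpow_mul (by norm_num), Real.rpow_natCast, hN]
    rw [hconv, hconv] at hmaj
    rw [hconv]
    have hlow : ∀ n : ℕ, n < a → psi φ (i + 3) n = 0 := by
      intro n hn
      have hn' : (n : ℝ) < a := by exact_mod_cast hn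
      have hn0 : (0 : ℝ) ≤ n := by positivity
      rw [psi_eq, hN, hone _ (by positivity), hone _ (by positivity)]
      · simp
      · rw [div_le_iff₀ (by positivity)]; linarith
      · rw [div_le_iff₀ (by positivity)]; linarith
    have hhigh : ∀ n : ℕ, 4 * a + 1 ≤ n → psi φ (i + 3) n = 0 := by
      intro n hn
      have hn' : 4 * (a : ℝ) + 1 ≤ n := by exact_mod_cast hn
      rw [psi_eq, hN, hz, hz]
      · simp
      · rw [lt_div_iff₀ (by positivity)]; linarith
      · rw [lt_div_iff₀ (by positivity)]; linarith
    have hψ1 : ∀ n : ℕ, a ≤ n → |psi φ (i + 3) n| ≤ 1 / a := by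
      intro n hn
      have hn' : (a : ℝ) ≤ n := by exact_mod_cast hn
      refine (hpsi1 _ n (by linarith)).trans ?_
      gcongr
    have hψ2 : ∀ n : ℕ, a ≤ n →
        |psi φ (i + 3) ((n + 1 : ℕ) : ℝ) - psi φ (i + 3) n| ≤ (L0 + 1) / (a : ℝ) ^ 2 := by
      intro n hn
      have hn' : (a : ℝ) ≤ n := by exact_mod_cast hn
      have hn0 : (0 : ℝ) < n := by linarith
      have hL : (0 : ℝ) ≤ L0 := L0.2
      rw [psi_eq, psi_eq, hN]
      set x : ℝ := (n : ℝ) with hx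
      have hx1 : ((n + 1 : ℕ) : ℝ) = x + 1 := by push_cast; rfl
      rw [hx1]
      set p := φ ((x + 1) / (8 * a)) with hp
      set q := φ (2 * (x + 1) / (8 * a)) with hq
      set r := φ (x / (8 * a)) with hr
      set s := φ (2 * x / (8 * a)) with hs
      have e1 : |p - r| ≤ L0 * (1 / (8 * a)) := by
        have := hlip ((x + 1) / (8 * a)) (x / (8 * a))
        rwa [← sub_div, add_sub_cancel_left, abs_of_pos (by positivity : (0 : ℝ) < 1 / (8 * a))] at this
      have e2 : |q - s| ≤ L0 * (2 / (8 * a)) := by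
        have := hlip (2 * (x + 1) / (8 * a)) (2 * x / (8 * a))
        rwa [← sub_div, ← mul_sub, add_sub_cancel_left, mul_one, abs_of_pos (by positivity : (0 : ℝ) < 2 / (8 * a))] at this
      have e3 : |r - s| ≤ 1 := hu _ _
      have key : (p - q) / (x + 1) - (r - s) / x =
          ((p - r) - (q - s)) / (x + 1) - (r - s) / (x * (x + 1)) := by
        field_simp; ring
      rw [key]
      refine (abs_sub _ _).trans ?_
      have e4 : |((p - r) - (q - s)) / (x + 1)| ≤ L0 / (a : ℝ) ^ 2 := by
        rw [abs_div, abs_of_pos (by positivity : 0 < x + 1)]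
        have e5 : |(p - r) - (q - s)| ≤ L0 / a := by
          refine (abs_sub _ _).trans ((add_le_add e1 e2).trans ?_)
          have : L0 * (1 / (8 * (a : ℝ))) + L0 * (2 / (8 * a)) = (3 / 8) * (L0 / a) := by
            field_simp; ring
          rw [this]
          have : 0 ≤ (L0 : ℝ) / a := by positivity
          linarith
        calc _ ≤ (L0 / a : ℝ) / a := by gcongr; linarith
          _ = _ := by field_simp
      have e6 : |(r - s) / (x * (x + 1))| ≤ 1 / (a : ℝ) ^ 2 := by
        rw [abs_div, abs_of_pos (by positivity : 0 < x * (x + 1))]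
        gcongr
        nlinarith
      rw [add_div]
      exact add_le_add e4 e6
    have hred : ∀ η : ℝ, ∑ n ∈ Finset.Ico (1 : ℕ) (2 ^ (i + 3) + 1),
        e (lam * (⌊(n : ℝ) ^ c⌋ : ℝ) - η * n) * (psi φ (i + 3) n : ℂ) =
        ∑ n ∈ Finset.Ico a (4 * a + 1),
        e (lam * (⌊(n : ℝ) ^ c⌋ : ℝ) - η * n) * (psi φ (i + 3) n : ℂ) := by
      intro η
      symm
      apply Finset.sum_subset
      · intro n hn
        rw [Finset.mem_Ico] at hn ⊢
        omega
      · intro n _ hn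
        rw [Finset.mem_Ico] at hn
        have : psi φ (i + 3) n = 0 := by
          by_cases h : n < a
          · exact hlow n h
          · exact hhigh n (by omega)
        rw [this]; simp
    have hb : ∀ η : ℝ, |η| = |ξ| → ‖∑ n ∈ Finset.Ico (1 : ℕ) (2 ^ (i + 3) + 1),
        e (lam * (⌊(n : ℝ) ^ c⌋ : ℝ) - η * n) * (psi φ (i + 3) n : ℂ)‖ ≤
          C * (8 * (a : ℝ)) ^ (-(ε / 4)) := by
      intro η hη
      rw [hred]
      exact hcore a (8 * a) η lam (fun n => psi φ (i + 3) n) ha1 rfl (by rwa [hη]) hlam'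
        (by rwa [hη]) hψ1 hψ2
    refine (norm_sub_le _ _).trans ?_
    have h1 := hb ξ rfl
    have h2 := hb (-ξ) (abs_neg ξ)
    have h3 : 0 ≤ (8 * (a : ℝ)) ^ (-(ε / 4)) := by positivity
    nlinarith
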